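/- Let W be any vector field on 𝕊¹_ℓ×𝔻² that is tangent to the boundary and satisfies Curl W = F, ddiv W = ρ for a scalar function ρ and a vector field F. Then for every nonnegative integer k, with constants C_k independent of ε: (i) ‖W_α‖_{H^k} + ‖D_y W_α‖_{H^k} ≤ C_k(ε‖F‖_{H^k_ε} + ‖ρ‖_{H^k} + |𝒬[W]|); (ii) ‖∂_α W_α‖_{H^k} ≤ C_k(‖F‖_{H^k_ε} + ‖ρ‖_{H^k}); (iii) ‖W_y‖_{H^k} + ε‖∂_α W_y‖_{H^k} + ‖D_y W_y‖_{H^k} ≤ C_k(‖F‖_{H^k_ε} + ‖ρ‖_{H^k} + |𝒬[W]|). -/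

import Mathlib

open Filter Topology MeasureTheory Real
open scoped RealInnerProductSpace

set_option linter.unusedVariables false
noncomputable section

/-- Coordinates `(α, y₁, y₂)` on `𝕊¹_ℓ × 𝔻²`. -/
abbrev P3 := ℝ × ℝ × ℝ

/-- Partial derivative in the slow variable `α`. -/
def pA (f : P3 → ℝ) (p : P3) : ℝ := fderiv ℝ f p (1, 0, 0)
/-- Partial derivative in the fast variable `y₁`. -/
def p1 (f : P3 → ℝ) (p : P3) : ℝ := fderiv ℝ f p (0, 1, 0)
/-- Partial derivative in the fast variable `y₂`. -/
def p2 (f : P3 → ℝ) (p : P3) : ℝ := fderiv ℝ f p (0, 0, 1)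

/-- The fundamental domain `(0, ℓ] × 𝔻²` of `𝕊¹_ℓ × 𝔻²`. -/
def domP (ℓ : ℝ) : Set P3 := (Set.Ioc 0 ℓ) ×ˢ {y : ℝ × ℝ | y.1 ^ 2 + y.2 ^ 2 ≤ 1}

/-- The closed solid torus `𝕊¹_ℓ × 𝔻²` in the coordinates `(α, y)` (all `α`). -/
def domC : Set P3 := {p : P3 | p.2.1 ^ 2 + p.2.2 ^ 2 ≤ 1}

/-- Squared `L²` norm on `𝕊¹_ℓ × 𝔻²`. -/
def L2sq (ℓ : ℝ) (f : P3 → ℝ) : ℝ := ∫ p in domP ℓ, (f p) ^ 2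

/-- Squared Sobolev `H^k` norm on `𝕊¹_ℓ × 𝔻²`. -/
def SobSq (ℓ : ℝ) (k : ℕ) (f : P3 → ℝ) : ℝ :=
  ∑ j ∈ Finset.range (k + 1), ∫ p in domP ℓ, ‖iteratedFDeriv ℝ j f p‖ ^ 2

/-- `ℓ`-periodicity in the angular variable `α`. -/
def PerA (ℓ : ℝ) (f : P3 → ℝ) : Prop := ∀ p : P3, f (p.1 + ℓ, p.2.1, p.2.2) = f p

/-- The divergence-type operator `ddiv W = ∂_αW_α + ∂₁W₁ + ∂₂W₂`. -/
def ddivP (Wa W1 W2 : P3 → ℝ) (p : P3) : ℝ := pA Wa p + p1 W1 p + p2 W2 p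

/-- The `α`-component of `Curl W`. -/
def curlPα (Wa W1 W2 : P3 → ℝ) (p : P3) : ℝ := p1 W2 p - p2 W1 p
/-- The `y₁`-component of `Curl W`. -/
def curlP1 (ε : ℝ) (Wa W1 W2 : P3 → ℝ) (p : P3) : ℝ := (ε ^ 2)⁻¹ * p2 Wa p - pA W2 p
/-- The `y₂`-component of `Curl W`. -/
def curlP2 (ε : ℝ) (Wa W1 W2 : P3 → ℝ) (p : P3) : ℝ := pA W1 p - (ε ^ 2)⁻¹ * p1 Wa p

/-- Tangency to the boundary `𝕊¹_ℓ × ∂𝔻²`: `y · W_y = 0` on `|y| = 1`. -/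
def TangentP (W1 W2 : P3 → ℝ) : Prop :=
  ∀ p : P3, p.2.1 ^ 2 + p.2.2 ^ 2 = 1 → p.2.1 * W1 p + p.2.2 * W2 p = 0

/-- The harmonic-part functional `𝒬[W] = ∫ W_α dα dy`. -/
def QP (ℓ : ℝ) (Wa : P3 → ℝ) : ℝ := ∫ p in domP ℓ, Wa p

/-- The squared `H^k_ε` norm `‖W‖² = ‖W_α‖²_{H^k} + ε²‖W_y‖²_{H^k}`. -/
def HkEpsSq (ε ℓ : ℝ) (k : ℕ) (Wa W1 W2 : P3 → ℝ) : ℝ :=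
  SobSq ℓ k Wa + ε ^ 2 * (SobSq ℓ k W1 + SobSq ℓ k W2)

/-! ## Calculus of partial derivatives -/

abbrev Sm (f : P3 → ℝ) : Prop := ContDiff ℝ (⊤ : ℕ∞) f

/-- directional derivative -/
def dv (v : P3) (f : P3 → ℝ) (p : P3) : ℝ := fderiv ℝ f p v

lemma pA_eq : pA = dv (1, 0, 0) := rfl
lemma p1_eq : p1 = dv (0, 1, 0) := rfl
lemma p2_eq : p2 = dv (0, 0, 1) := rfl

lemma Sm.diff {f : P3 → ℝ} (hf : Sm f) : Differentiable ℝ f :=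
  ContDiff.differentiable hf (by simp)

lemma Sm.cont {f : P3 → ℝ} (hf : Sm f) : Continuous f := ContDiff.continuous hf

lemma Sm.fd {f : P3 → ℝ} (hf : Sm f) : ContDiff ℝ (⊤ : ℕ∞) (fderiv ℝ f) :=
  ContDiff.fderiv_right hf (m := (⊤ : ℕ∞)) (by simp)

lemma Sm.dv {f : P3 → ℝ} (hf : Sm f) (v : P3) : Sm (dv v f) :=
  hf.fd.clm_apply contDiff_const

lemma Sm.pA {f : P3 → ℝ} (hf : Sm f) : Sm (pA f) := hf.dv _
lemma Sm.p1 {f : P3 → ℝ} (hf : Sm f) : Sm (p1 f) := hf.dv _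
lemma Sm.p2 {f : P3 → ℝ} (hf : Sm f) : Sm (p2 f) := hf.dv _
lemma Sm.add' {f g : P3 → ℝ} (hf : Sm f) (hg : Sm g) : Sm (f + g) := ContDiff.add hf hg
lemma Sm.sub' {f g : P3 → ℝ} (hf : Sm f) (hg : Sm g) : Sm (f - g) := ContDiff.sub hf hg
lemma Sm.mul' {f g : P3 → ℝ} (hf : Sm f) (hg : Sm g) : Sm (f * g) := ContDiff.mul hf hg
lemma Sm.neg' {f : P3 → ℝ} (hf : Sm f) : Sm (-f) := ContDiff.neg hf
lemma Sm.smul' {f : P3 → ℝ} (hf : Sm f) (c : ℝ) : Sm (c • f) := ContDiff.const_smul c hf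

lemma dv_add (v : P3) {f g : P3 → ℝ} (hf : Sm f) (hg : Sm g) :
    dv v (f + g) = dv v f + dv v g := by
  ext p
  simp only [dv, Pi.add_apply]
  rw [fderiv_add (hf.diff p) (hg.diff p)]; rfl

lemma dv_sub (v : P3) {f g : P3 → ℝ} (hf : Sm f) (hg : Sm g) :
    dv v (f - g) = dv v f - dv v g := by
  ext p
  simp only [dv, Pi.sub_apply]
  rw [fderiv_sub (hf.diff p) (hg.diff p)]; rfl

lemma dv_smul (v : P3) {f : P3 → ℝ} (hf : Sm f) (c : ℝ) :
    dv v (c • f) = c • dv v f := by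
  ext p
  simp only [dv, Pi.smul_apply]
  rw [fderiv_const_smul (hf.diff p)]; rfl

lemma dv_mul (v : P3) {f g : P3 → ℝ} (hf : Sm f) (hg : Sm g) :
    dv v (f * g) = dv v f * g + f * dv v g := by
  ext p
  simp only [dv, Pi.add_apply, Pi.mul_apply]
  rw [fderiv_mul (hf.diff p) (hg.diff p)]
  simp; ring

lemma dv_comm (v w : P3) {f : P3 → ℝ} (hf : Sm f) : dv v (dv w f) = dv w (dv v f) := by
  ext p
  have h : ∀ (a b : P3), dv a (dv b f) p = fderiv ℝ (fderiv ℝ f) p a b := by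
    intro a b
    have hd : DifferentiableAt ℝ (fderiv ℝ f) p := (hf.fd.differentiable (by simp)) p
    have := hd.hasFDerivAt.clm_apply (hasFDerivAt_const b p)
    show fderiv ℝ (fun q => fderiv ℝ f q b) p a = _
    rw [this.fderiv]; simp
  rw [h, h]
  have : ContDiffAt ℝ (⊤ : ℕ∞) f p := ContDiff.contDiffAt hf
  exact this.isSymmSndFDerivAt (by simp; exact WithTop.coe_le_coe.2 le_top) v w

lemma pA_p1 {f : P3 → ℝ} (hf : Sm f) : pA (p1 f) = p1 (pA f) := dv_comm _ _ hf
lemma pA_p2 {f : P3 → ℝ} (hf : Sm f) : pA (p2 f) = p2 (pA f) := dv_comm _ _ hf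
lemma p1_p2 {f : P3 → ℝ} (hf : Sm f) : p1 (p2 f) = p2 (p1 f) := dv_comm _ _ hf

/-- coordinate functions -/
def y1 : P3 → ℝ := fun p => p.2.1
def y2 : P3 → ℝ := fun p => p.2.2

lemma sm_y1 : Sm y1 := contDiff_fst.comp contDiff_snd
lemma sm_y2 : Sm y2 := contDiff_snd.comp contDiff_snd

lemma dv_y1 (v : P3) : dv v y1 = fun _ => v.2.1 := by
  ext p
  have : HasFDerivAt y1 ((ContinuousLinearMap.fst ℝ ℝ ℝ).comp (ContinuousLinearMap.snd ℝ ℝ (ℝ × ℝ))) p :=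
    hasFDerivAt_fst.comp p hasFDerivAt_snd
  simp [dv, this.fderiv]

lemma dv_y2 (v : P3) : dv v y2 = fun _ => v.2.2 := by
  ext p
  have : HasFDerivAt y2 ((ContinuousLinearMap.snd ℝ ℝ ℝ).comp (ContinuousLinearMap.snd ℝ ℝ (ℝ × ℝ))) p :=
    hasFDerivAt_snd.comp p hasFDerivAt_snd
  simp [dv, this.fderiv]

lemma dv_y1mul (v : P3) {f : P3 → ℝ} (hf : Sm f) : dv v (y1 * f) = v.2.1 • f + y1 * dv v f := by
  rw [dv_mul v sm_y1 hf, dv_y1]; ext p; simp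
lemma dv_y2mul (v : P3) {f : P3 → ℝ} (hf : Sm f) : dv v (y2 * f) = v.2.2 • f + y2 * dv v f := by
  rw [dv_mul v sm_y2 hf, dv_y2]; ext p; simp

lemma p1_y1 {f : P3 → ℝ} (hf : Sm f) : p1 (y1 * f) = f + y1 * p1 f := by
  rw [p1_eq, dv_y1mul _ hf]; simp
lemma p2_y1 {f : P3 → ℝ} (hf : Sm f) : p2 (y1 * f) = y1 * p2 f := by
  rw [p2_eq, dv_y1mul _ hf]; simp
lemma p1_y2 {f : P3 → ℝ} (hf : Sm f) : p1 (y2 * f) = y2 * p1 f := by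
  rw [p1_eq, dv_y2mul _ hf]; simp
lemma p2_y2 {f : P3 → ℝ} (hf : Sm f) : p2 (y2 * f) = f + y2 * p2 f := by
  rw [p2_eq, dv_y2mul _ hf]; simp

lemma PerA.dv {ℓ : ℝ} {f : P3 → ℝ} (hf : PerA ℓ f) (v : P3) : PerA ℓ (dv v f) := by
  intro p
  have h : f = fun q => f (q + (ℓ, 0, 0)) := by
    ext q
    have := hf q
    rw [← this]; congr 1; ext <;> simp
  show fderiv ℝ f _ v = fderiv ℝ f p v
  conv_rhs => rw [h]
  rw [fderiv_comp_add_right]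
  congr 2; ext <;> simp

lemma PerA.mul' {ℓ : ℝ} {f g : P3 → ℝ} (hf : PerA ℓ f) (hg : PerA ℓ g) : PerA ℓ (f * g) := by
  intro p; simp [hf p, hg p]

lemma sm_iter {f : P3 → ℝ} (hf : Sm f) (a : ℕ) : Sm (pA^[a] f) := by
  induction a generalizing f with
  | zero => exact hf
  | succ a ih => exact ih hf.pA

lemma per_iter {ℓ : ℝ} {f : P3 → ℝ} (hf : PerA ℓ f) (a : ℕ) : PerA ℓ (pA^[a] f) := by
  induction a generalizing f with
  | zero => exact hf
  | succ a ih => exact ih (hf.dv _)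

lemma iter_p1 {f : P3 → ℝ} (hf : Sm f) (a : ℕ) : pA^[a] (p1 f) = p1 (pA^[a] f) := by
  induction a generalizing f with
  | zero => rfl
  | succ a ih => rw [Function.iterate_succ_apply, pA_p1 hf, ih hf.pA, Function.iterate_succ_apply]

lemma iter_p2 {f : P3 → ℝ} (hf : Sm f) (a : ℕ) : pA^[a] (p2 f) = p2 (pA^[a] f) := by
  induction a generalizing f with
  | zero => rfl
  | succ a ih => rw [Function.iterate_succ_apply, pA_p2 hf, ih hf.pA, Function.iterate_succ_apply]

lemma iter_pA (f : P3 → ℝ) (a : ℕ) : pA^[a] (pA f) = pA (pA^[a] f) := by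
  rw [← Function.iterate_succ_apply, Function.iterate_succ_apply']

lemma iter_add {f g : P3 → ℝ} (hf : Sm f) (hg : Sm g) (a : ℕ) :
    pA^[a] (f + g) = pA^[a] f + pA^[a] g := by
  induction a generalizing f g with
  | zero => rfl
  | succ a ih => rw [Function.iterate_succ_apply, pA_eq, dv_add _ hf hg, ← pA_eq, ih hf.pA hg.pA]; rfl

lemma iter_sub {f g : P3 → ℝ} (hf : Sm f) (hg : Sm g) (a : ℕ) :
    pA^[a] (f - g) = pA^[a] f - pA^[a] g := by
  induction a generalizing f g with
  | zero => rfl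
  | succ a ih => rw [Function.iterate_succ_apply, pA_eq, dv_sub _ hf hg, ← pA_eq, ih hf.pA hg.pA]; rfl

lemma iter_smul {f : P3 → ℝ} (hf : Sm f) (c : ℝ) (a : ℕ) :
    pA^[a] (c • f) = c • pA^[a] f := by
  induction a generalizing f with
  | zero => rfl
  | succ a ih => rw [Function.iterate_succ_apply, pA_eq, dv_smul _ hf, ← pA_eq, ih hf.pA]; rfl


/-! ## L² norms and Sobolev norms -/

def disk : Set (ℝ × ℝ) := {y : ℝ × ℝ | y.1 ^ 2 + y.2 ^ 2 ≤ 1}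

lemma domP_eq (ℓ : ℝ) : domP ℓ = Set.Ioc 0 ℓ ×ˢ disk := rfl

lemma disk_closed : IsClosed disk :=
  isClosed_le (by fun_prop) continuous_const

lemma disk_sub : disk ⊆ Set.Icc (-1) 1 ×ˢ Set.Icc (-1) 1 := by
  rintro ⟨a, b⟩ h
  simp only [disk, Set.mem_ofPred_eq] at h
  simp only [Set.mem_prod, Set.mem_Icc]
  refine ⟨⟨?_, ?_⟩, ?_, ?_⟩ <;> nlinarith [sq_nonneg a, sq_nonneg b]

lemma disk_compact : IsCompact disk :=
  IsCompact.of_isClosed_subset (isCompact_Icc.prod isCompact_Icc) disk_closed disk_sub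

lemma domP_meas (ℓ : ℝ) : MeasurableSet (domP ℓ) :=
  measurableSet_Ioc.prod disk_closed.measurableSet

lemma domP_sub (ℓ : ℝ) : domP ℓ ⊆ Set.Icc 0 ℓ ×ˢ disk :=
  Set.prod_mono Set.Ioc_subset_Icc_self le_rfl

lemma intOn {ℓ : ℝ} {f : P3 → ℝ} (hf : Continuous f) : IntegrableOn f (domP ℓ) :=
  (hf.continuousOn.integrableOn_compact (isCompact_Icc.prod disk_compact)).mono_set (domP_sub ℓ)

/-- integral on the solid torus -/
def II (ℓ : ℝ) (f : P3 → ℝ) : ℝ := ∫ p in domP ℓ, f p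

lemma II_add {ℓ : ℝ} {f g : P3 → ℝ} (hf : Continuous f) (hg : Continuous g) :
    II ℓ (f + g) = II ℓ f + II ℓ g := integral_add (intOn hf) (intOn hg)
lemma II_sub {ℓ : ℝ} {f g : P3 → ℝ} (hf : Continuous f) (hg : Continuous g) :
    II ℓ (f - g) = II ℓ f - II ℓ g := integral_sub (intOn hf) (intOn hg)
lemma II_smul {ℓ : ℝ} (c : ℝ) (f : P3 → ℝ) : II ℓ (c • f) = c * II ℓ f := integral_const_mul _ _
lemma II_mono {ℓ : ℝ} {f g : P3 → ℝ} (hf : Continuous f) (hg : Continuous g)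
    (h : ∀ p : P3, p.2.1 ^ 2 + p.2.2 ^ 2 ≤ 1 → f p ≤ g p) : II ℓ f ≤ II ℓ g :=
  setIntegral_mono_on (intOn hf) (intOn hg) (domP_meas ℓ) (fun p hp => h p hp.2)
lemma II_nonneg {ℓ : ℝ} {f : P3 → ℝ} (h : ∀ p, 0 ≤ f p) : 0 ≤ II ℓ f :=
  integral_nonneg h

/-- L² norm -/
def nn (ℓ : ℝ) (f : P3 → ℝ) : ℝ := Real.sqrt (II ℓ (f * f))

lemma nn_nonneg (ℓ : ℝ) (f : P3 → ℝ) : 0 ≤ nn ℓ f := Real.sqrt_nonneg _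

lemma nn_sq (ℓ : ℝ) (f : P3 → ℝ) : nn ℓ f ^ 2 = II ℓ (f * f) :=
  Real.sq_sqrt (II_nonneg fun p => mul_self_nonneg _)

lemma le_of_sq_le_sq'' {a b : ℝ} (h : a ^ 2 ≤ b ^ 2) (hb : 0 ≤ b) : a ≤ b :=
  (le_abs_self a).trans (abs_le_of_sq_le_sq h hb)

lemma II_cs {ℓ : ℝ} {f g : P3 → ℝ} (hf : Continuous f) (hg : Continuous g) :
    II ℓ (f * g) ≤ nn ℓ f * nn ℓ g := by
  have key : ∀ t : ℝ, 0 ≤ nn ℓ f ^ 2 * (t * t) + (2 * II ℓ (f * g)) * t + nn ℓ g ^ 2 := by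
    intro t
    have h : 0 ≤ II ℓ ((t * t) • (f * f) + (2 * t) • (f * g) + g * g) :=
      II_nonneg fun p => by
        simp only [Pi.add_apply, Pi.smul_apply, Pi.mul_apply, smul_eq_mul]
        nlinarith [sq_nonneg (t * f p + g p)]
    rw [II_add (by fun_prop) (by fun_prop), II_add (by fun_prop) (by fun_prop), II_smul, II_smul] at h
    rw [nn_sq, nn_sq]; linarith
  have := discrim_le_zero key
  rw [discrim] at this
  refine le_of_sq_le_sq'' ?_ (mul_nonneg (nn_nonneg _ _) (nn_nonneg _ _))
  nlinarith

lemma nn_add {ℓ : ℝ} {f g : P3 → ℝ} (hf : Continuous f) (hg : Continuous g) :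
    nn ℓ (f + g) ≤ nn ℓ f + nn ℓ g := by
  refine le_of_sq_le_sq'' ?_ (add_nonneg (nn_nonneg _ _) (nn_nonneg _ _))
  have e : (f + g) * (f + g) = f * f + (2 : ℝ) • (f * g) + g * g := by
    ext p; simp; ring
  rw [nn_sq, e, II_add (by fun_prop) (by fun_prop), II_add (by fun_prop) (by fun_prop), II_smul]
  have := II_cs (ℓ := ℓ) hf hg
  have := nn_sq ℓ f; have := nn_sq ℓ g
  nlinarith

lemma nn_smul {ℓ : ℝ} (c : ℝ) (f : P3 → ℝ) : nn ℓ (c • f) = |c| * nn ℓ f := by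
  have e : (c • f) * (c • f) = (c ^ 2) • (f * f) := by ext p; simp; ring
  rw [nn, e, II_smul, Real.sqrt_mul (sq_nonneg _), Real.sqrt_sq_eq_abs]; rfl

lemma nn_mono {ℓ : ℝ} {f g : P3 → ℝ} (hf : Continuous f) (hg : Continuous g)
    (h : ∀ p : P3, p.2.1 ^ 2 + p.2.2 ^ 2 ≤ 1 → |f p| ≤ |g p|) : nn ℓ f ≤ nn ℓ g :=
  Real.sqrt_le_sqrt (II_mono (by fun_prop) (by fun_prop) fun p hp => by
    simpa [← sq] using sq_le_sq.2 (h p hp))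

/-- full Sobolev norm -/
def XX (ℓ : ℝ) : ℕ → (P3 → ℝ) → ℝ
  | 0, f => nn ℓ f
  | k + 1, f => nn ℓ f + XX ℓ k (pA f) + XX ℓ k (p1 f) + XX ℓ k (p2 f)

/-- Sobolev norm in y -/
def YY (ℓ : ℝ) : ℕ → (P3 → ℝ) → ℝ
  | 0, f => nn ℓ f
  | k + 1, f => nn ℓ f + YY ℓ k (p1 f) + YY ℓ k (p2 f)

lemma XX_nonneg (ℓ : ℝ) (k : ℕ) (f : P3 → ℝ) : 0 ≤ XX ℓ k f := by
  induction k generalizing f with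
  | zero => exact nn_nonneg _ _
  | succ k ih => have := nn_nonneg ℓ f; have := ih (pA f); have := ih (p1 f); have := ih (p2 f); simp only [XX]; linarith

lemma YY_nonneg (ℓ : ℝ) (k : ℕ) (f : P3 → ℝ) : 0 ≤ YY ℓ k f := by
  induction k generalizing f with
  | zero => exact nn_nonneg _ _
  | succ k ih => have := nn_nonneg ℓ f; have := ih (p1 f); have := ih (p2 f); simp only [YY]; linarith

lemma YY_add {ℓ : ℝ} (k : ℕ) {f g : P3 → ℝ} (hf : Sm f) (hg : Sm g) :
    YY ℓ k (f + g) ≤ YY ℓ k f + YY ℓ k g := by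
  induction k generalizing f g with
  | zero => exact nn_add hf.cont hg.cont
  | succ k ih =>
    have := nn_add (ℓ := ℓ) hf.cont hg.cont
    have := ih hf.p1 hg.p1; have := ih hf.p2 hg.p2
    simp only [YY]
    rw [p1_eq, dv_add _ hf hg, p2_eq, dv_add _ hf hg, ← p1_eq, ← p2_eq]
    linarith

lemma YY_smul {ℓ : ℝ} (k : ℕ) {f : P3 → ℝ} (hf : Sm f) (c : ℝ) :
    YY ℓ k (c • f) = |c| * YY ℓ k f := by
  induction k generalizing f with
  | zero => exact nn_smul _ _
  | succ k ih =>
    simp only [YY]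
    rw [p1_eq, dv_smul _ hf, p2_eq, dv_smul _ hf, ← p1_eq, ← p2_eq, ih hf.p1, ih hf.p2, nn_smul]; ring

lemma YY_sub {ℓ : ℝ} (k : ℕ) {f g : P3 → ℝ} (hf : Sm f) (hg : Sm g) :
    YY ℓ k (f - g) ≤ YY ℓ k f + YY ℓ k g := by
  have e : f - g = f + (-1 : ℝ) • g := by ext p; simp; ring
  rw [e]
  refine (YY_add k hf (hg.smul' _)).trans ?_
  rw [YY_smul k hg]; simp

lemma nn_le_YY {ℓ : ℝ} (k : ℕ) (f : P3 → ℝ) : nn ℓ f ≤ YY ℓ k f := by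
  cases k with
  | zero => exact le_rfl
  | succ k => have := YY_nonneg ℓ k (p1 f); have := YY_nonneg ℓ k (p2 f); simp only [YY]; linarith

lemma YY_succ {ℓ : ℝ} (k : ℕ) (f : P3 → ℝ) : YY ℓ k f ≤ YY ℓ (k + 1) f := by
  induction k generalizing f with
  | zero => exact nn_le_YY 1 f
  | succ k ih =>
    have := ih (p1 f); have := ih (p2 f)
    show nn ℓ f + YY ℓ k (p1 f) + YY ℓ k (p2 f) ≤
      nn ℓ f + YY ℓ (k + 1) (p1 f) + YY ℓ (k + 1) (p2 f)
    linarith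

lemma YY_p1 {ℓ : ℝ} (k : ℕ) (f : P3 → ℝ) : YY ℓ k (p1 f) ≤ YY ℓ (k + 1) f := by
  have := YY_nonneg ℓ k (p2 f); have := nn_nonneg ℓ f; simp only [YY]; linarith
lemma YY_p2 {ℓ : ℝ} (k : ℕ) (f : P3 → ℝ) : YY ℓ k (p2 f) ≤ YY ℓ (k + 1) f := by
  have := YY_nonneg ℓ k (p1 f); have := nn_nonneg ℓ f; simp only [YY]; linarith

lemma abs_y1_le {p : P3} (hp : p.2.1 ^ 2 + p.2.2 ^ 2 ≤ 1) : |p.2.1| ≤ 1 := by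
  rw [abs_le]; constructor <;> nlinarith [sq_nonneg p.2.2]
lemma abs_y2_le {p : P3} (hp : p.2.1 ^ 2 + p.2.2 ^ 2 ≤ 1) : |p.2.2| ≤ 1 := by
  rw [abs_le]; constructor <;> nlinarith [sq_nonneg p.2.1]

lemma nn_y1 {ℓ : ℝ} {f : P3 → ℝ} (hf : Sm f) : nn ℓ (y1 * f) ≤ nn ℓ f :=
  nn_mono (sm_y1.mul' hf).cont hf.cont fun p hp => by
    simp only [Pi.mul_apply, abs_mul, y1]
    exact mul_le_of_le_one_left (abs_nonneg _) (abs_y1_le hp)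
lemma nn_y2 {ℓ : ℝ} {f : P3 → ℝ} (hf : Sm f) : nn ℓ (y2 * f) ≤ nn ℓ f :=
  nn_mono (sm_y2.mul' hf).cont hf.cont fun p hp => by
    simp only [Pi.mul_apply, abs_mul, y2]
    exact mul_le_of_le_one_left (abs_nonneg _) (abs_y2_le hp)

lemma YY_y1 {ℓ : ℝ} (k : ℕ) {f : P3 → ℝ} (hf : Sm f) : YY ℓ k (y1 * f) ≤ (k + 1) * YY ℓ k f := by
  induction k generalizing f with
  | zero => simpa [YY] using nn_y1 hf
  | succ k ih =>
    have h1 := nn_y1 (ℓ := ℓ) hf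
    have h2 := ih hf.p1
    have h3 := ih hf.p2
    have h4 := YY_add (ℓ := ℓ) k hf (sm_y1.mul' hf.p1)
    have h5 := YY_succ (ℓ := ℓ) k f
    have h6 := nn_nonneg ℓ f
    have h7 : (0:ℝ) ≤ (k + 1) * nn ℓ f := by positivity
    rw [YY] at h5
    rw [YY, YY, p1_y1 hf, p2_y1 hf]
    push_cast
    nlinarith

lemma YY_y2 {ℓ : ℝ} (k : ℕ) {f : P3 → ℝ} (hf : Sm f) : YY ℓ k (y2 * f) ≤ (k + 1) * YY ℓ k f := by
  induction k generalizing f with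
  | zero => simpa [YY] using nn_y2 hf
  | succ k ih =>
    have h1 := nn_y2 (ℓ := ℓ) hf
    have h2 := ih hf.p1
    have h3 := ih hf.p2
    have h4 := YY_add (ℓ := ℓ) k hf (sm_y2.mul' hf.p2)
    have h5 := YY_succ (ℓ := ℓ) k f
    have h6 := nn_nonneg ℓ f
    have h7 : (0:ℝ) ≤ (k + 1) * nn ℓ f := by positivity
    rw [YY] at h5
    rw [YY, YY, p1_y2 hf, p2_y2 hf]
    push_cast
    nlinarith

lemma XX_succ {ℓ : ℝ} (k : ℕ) (f : P3 → ℝ) : XX ℓ k f ≤ XX ℓ (k + 1) f := by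
  induction k generalizing f with
  | zero =>
    have := nn_nonneg ℓ (pA f); have := nn_nonneg ℓ (p1 f); have := nn_nonneg ℓ (p2 f)
    simp only [XX]; linarith
  | succ k ih =>
    have := ih (p1 f); have := ih (p2 f); have := ih (pA f)
    show nn ℓ f + XX ℓ k (pA f) + XX ℓ k (p1 f) + XX ℓ k (p2 f) ≤
      nn ℓ f + XX ℓ (k + 1) (pA f) + XX ℓ (k + 1) (p1 f) + XX ℓ (k + 1) (p2 f)
    linarith

lemma XX_mono {ℓ : ℝ} {j k : ℕ} (h : j ≤ k) (f : P3 → ℝ) : XX ℓ j f ≤ XX ℓ k f :=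
  monotone_nat_of_le_succ (f := fun k => XX ℓ k f) (fun k => XX_succ k f) h

lemma YY_le_XX {ℓ : ℝ} (b : ℕ) (f : P3 → ℝ) : YY ℓ b f ≤ XX ℓ b f := by
  induction b generalizing f with
  | zero => exact le_rfl
  | succ b ih =>
    have := ih (p1 f); have := ih (p2 f); have := XX_nonneg ℓ b (pA f)
    simp only [XX, YY]; linarith

lemma XX_iter {ℓ : ℝ} (a b : ℕ) (f : P3 → ℝ) : XX ℓ b (pA^[a] f) ≤ XX ℓ (a + b) f := by
  induction a generalizing f with
  | zero => simp
  | succ a ih =>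
    refine (ih (pA f)).trans ?_
    have := XX_nonneg ℓ (a+b) (p1 f); have := XX_nonneg ℓ (a+b) (p2 f); have := nn_nonneg ℓ f
    rw [show a + 1 + b = (a + b) + 1 by ring]
    simp only [XX]; linarith

lemma YY_iter_le {ℓ : ℝ} {a b k : ℕ} (h : a + b ≤ k) (f : P3 → ℝ) : YY ℓ b (pA^[a] f) ≤ XX ℓ k f :=
  (YY_le_XX b _).trans ((XX_iter a b f).trans (XX_mono h f))

lemma XX_le_of_YY {ℓ : ℝ} (k : ℕ) {f : P3 → ℝ} (hf : Sm f) {B : ℝ}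
    (h : ∀ a b, a + b ≤ k → YY ℓ b (pA^[a] f) ≤ B) : XX ℓ k f ≤ 4 ^ k * B := by
  induction k generalizing f B with
  | zero => simpa [XX, YY] using h 0 0 le_rfl
  | succ k ih =>
    have h1 := ih hf.pA (B := B) (fun a b hab => by
      have := h (a + 1) b (by omega)
      rwa [Function.iterate_succ_apply] at this)
    have h2 := ih hf.p1 (B := B) (fun a b hab => by
      rw [iter_p1 hf]
      exact (YY_p1 b _).trans (h a (b + 1) (by omega)))
    have h3 := ih hf.p2 (B := B) (fun a b hab => by
      rw [iter_p2 hf]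
      exact (YY_p2 b _).trans (h a (b + 1) (by omega)))
    have h4 : nn ℓ f ≤ B := h 0 0 (by omega)
    have h5 : B ≤ 4 ^ k * B := by
      have hB : 0 ≤ B := (nn_nonneg _ _).trans h4
      exact le_mul_of_one_le_left hB (one_le_pow₀ (by norm_num))
    rw [XX, pow_succ]; linarith


/-! ## Comparison with the Sobolev norms of the statement -/

def gj (j : ℕ) (f : P3 → ℝ) : P3 → ℝ := fun p => ‖iteratedFDeriv ℝ j f p‖

lemma gj_nonneg (j : ℕ) (f : P3 → ℝ) (p : P3) : 0 ≤ gj j f p := norm_nonneg _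

lemma gj_cont (j : ℕ) {f : P3 → ℝ} (hf : Sm f) : Continuous (gj j f) :=
  (ContDiff.continuous_iteratedFDeriv (m := j) (by exact WithTop.coe_le_coe.2 le_top) hf).norm

lemma gj_dv (j : ℕ) {f : P3 → ℝ} (hf : Sm f) (v : P3) (hv : ‖v‖ ≤ 1) (p : P3) :
    gj j (dv v f) p ≤ gj (j + 1) f p := by
  have h := ContinuousLinearMap.norm_iteratedFDeriv_comp_left
    (ContinuousLinearMap.apply ℝ ℝ v) (f := fderiv ℝ f) (x := p) (N := (⊤ : ℕ∞)) (n := j)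
    hf.fd.contDiffAt (by exact WithTop.coe_le_coe.2 le_top)
  rw [norm_iteratedFDeriv_fderiv] at h
  refine h.trans ?_
  have h1 : ‖ContinuousLinearMap.apply ℝ ℝ v‖ ≤ 1 := by
    refine ContinuousLinearMap.opNorm_le_bound _ zero_le_one fun L => ?_
    rw [ContinuousLinearMap.apply_apply, one_mul]
    exact (L.le_opNorm v).trans (mul_le_of_le_one_right (norm_nonneg _) hv)
  exact mul_le_of_le_one_left (norm_nonneg _) h1

lemma gj_succ (j : ℕ) {f : P3 → ℝ} (hf : Sm f) (p : P3) :
    gj (j + 1) f p ≤ gj j (pA f) p + gj j (p1 f) p + gj j (p2 f) p := by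
  set dA : P3 →L[ℝ] ℝ := ContinuousLinearMap.fst ℝ ℝ (ℝ × ℝ)
  set d1 : P3 →L[ℝ] ℝ := (ContinuousLinearMap.fst ℝ ℝ ℝ).comp (ContinuousLinearMap.snd ℝ ℝ (ℝ × ℝ))
  set d2 : P3 →L[ℝ] ℝ := (ContinuousLinearMap.snd ℝ ℝ ℝ).comp (ContinuousLinearMap.snd ℝ ℝ (ℝ × ℝ))
  have nA : ‖dA‖ ≤ 1 := ContinuousLinearMap.norm_fst_le _ _ _
  have n1 : ‖d1‖ ≤ 1 := (ContinuousLinearMap.opNorm_comp_le _ _).trans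
    (mul_le_one₀ (ContinuousLinearMap.norm_fst_le _ _ _) (norm_nonneg _) (ContinuousLinearMap.norm_snd_le _ _ _))
  have n2 : ‖d2‖ ≤ 1 := (ContinuousLinearMap.opNorm_comp_le _ _).trans
    (mul_le_one₀ (ContinuousLinearMap.norm_snd_le _ _ _) (norm_nonneg _) (ContinuousLinearMap.norm_snd_le _ _ _))
  have e : fderiv ℝ f = (ContinuousLinearMap.toSpanSingleton ℝ dA ∘ pA f +
      ContinuousLinearMap.toSpanSingleton ℝ d1 ∘ p1 f) +
      ContinuousLinearMap.toSpanSingleton ℝ d2 ∘ p2 f := by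
    ext q
    · simp [dA, d1, d2, pA, p1, p2]; rfl
    · simp [dA, d1, d2, pA, p1, p2]
    · simp [dA, d1, d2, pA, p1, p2]
  have hj : ((j : ℕ) : WithTop ℕ∞) ≤ ((⊤ : ℕ∞) : WithTop ℕ∞) := WithTop.coe_le_coe.2 le_top
  have key : ∀ (d : P3 →L[ℝ] ℝ) (h : P3 → ℝ), ‖d‖ ≤ 1 → Sm h →
      ContDiff ℝ (⊤ : ℕ∞) (ContinuousLinearMap.toSpanSingleton ℝ d ∘ h) ∧
      ‖iteratedFDeriv ℝ j (ContinuousLinearMap.toSpanSingleton ℝ d ∘ h) p‖ ≤ gj j h p := by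
    intro d h hd hh
    refine ⟨(ContinuousLinearMap.contDiff _).comp hh, ?_⟩
    refine (ContinuousLinearMap.norm_iteratedFDeriv_comp_left _ (N := (⊤ : ℕ∞)) (ContDiff.contDiffAt hh) hj).trans ?_
    rw [ContinuousLinearMap.norm_toSpanSingleton]
    exact mul_le_of_le_one_left (norm_nonneg _) hd
  obtain ⟨sA, bA⟩ := key dA (pA f) nA hf.pA
  obtain ⟨s1, b1⟩ := key d1 (p1 f) n1 hf.p1
  obtain ⟨s2, b2⟩ := key d2 (p2 f) n2 hf.p2
  have := (norm_iteratedFDeriv_fderiv (𝕜 := ℝ) (f := f) (x := p) (n := j)).symm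
  rw [gj, this, e, iteratedFDeriv_add_apply (f := _ + _) ((sA.add s1).contDiffAt.of_le hj) (s2.contDiffAt.of_le hj)]
  rw [iteratedFDeriv_add_apply (sA.contDiffAt.of_le hj) (s1.contDiffAt.of_le hj)]
  exact (norm_add₃_le).trans (by gcongr)

lemma nn_gj_dv {ℓ : ℝ} (j : ℕ) {f : P3 → ℝ} (hf : Sm f) (v : P3) (hv : ‖v‖ ≤ 1) :
    nn ℓ (gj j (dv v f)) ≤ nn ℓ (gj (j + 1) f) :=
  nn_mono (gj_cont j (hf.dv v)) (gj_cont _ hf) fun p _ => by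
    rw [abs_of_nonneg (gj_nonneg _ _ _), abs_of_nonneg (gj_nonneg _ _ _)]
    exact gj_dv j hf v hv p

lemma nn_gj_succ {ℓ : ℝ} (j : ℕ) {f : P3 → ℝ} (hf : Sm f) :
    nn ℓ (gj (j + 1) f) ≤ nn ℓ (gj j (pA f)) + nn ℓ (gj j (p1 f)) + nn ℓ (gj j (p2 f)) := by
  have cA := gj_cont j hf.pA
  have c1 := gj_cont j hf.p1
  have c2 := gj_cont j hf.p2
  have h := nn_mono (ℓ := ℓ) (gj_cont (j + 1) hf) ((cA.add c1).add c2) fun p _ => by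
    rw [abs_of_nonneg (gj_nonneg _ _ _)]
    exact (gj_succ j hf p).trans (le_abs_self _)
  exact h.trans ((nn_add (cA.add c1) c2).trans (by gcongr; exact nn_add cA c1))

lemma nn_gj_zero {ℓ : ℝ} (f : P3 → ℝ) : nn ℓ (gj 0 f) = nn ℓ f := by
  have : gj 0 f * gj 0 f = f * f := by ext p; simp [gj, norm_iteratedFDeriv_zero]
  rw [nn, this]; rfl

lemma nn_gj_le {ℓ : ℝ} (j : ℕ) {f : P3 → ℝ} (hf : Sm f) : nn ℓ (gj j f) ≤ XX ℓ j f := by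
  induction j generalizing f with
  | zero => exact (nn_gj_zero f).le
  | succ j ih =>
    refine (nn_gj_succ j hf).trans ?_
    have := ih hf.pA; have := ih hf.p1; have := ih hf.p2; have := nn_nonneg ℓ f
    rw [XX]; linarith

lemma XX_le_gj {ℓ : ℝ} (k : ℕ) {f : P3 → ℝ} (hf : Sm f) {B : ℝ}
    (h : ∀ j ≤ k, nn ℓ (gj j f) ≤ B) : XX ℓ k f ≤ 4 ^ k * B := by
  have hh : ∀ v : P3, ‖v‖ ≤ 1 → (∀ k' , k = k' + 1 → ∀ j ≤ k', nn ℓ (gj j (dv v f)) ≤ B) :=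
    fun v hv k' hk j hj => (nn_gj_dv j hf v hv).trans (h _ (by omega))
  induction k generalizing f B with
  | zero => simpa [XX, nn_gj_zero] using h 0 le_rfl
  | succ k ih =>
    have key : ∀ v : P3, ‖v‖ ≤ 1 → XX ℓ k (dv v f) ≤ 4 ^ k * B := fun v hv =>
      ih (hf.dv v) (hh v hv k rfl) (fun w hw k' hk j hj =>
        (nn_gj_dv j (hf.dv v) w hw).trans (hh v hv k rfl _ (by omega)))
    have h1 : XX ℓ k (pA f) ≤ 4 ^ k * B := key _ (by simp [Prod.norm_def])
    have h2 : XX ℓ k (p1 f) ≤ 4 ^ k * B := key _ (by simp [Prod.norm_def])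
    have h3 : XX ℓ k (p2 f) ≤ 4 ^ k * B := key _ (by simp [Prod.norm_def])
    have h4 : nn ℓ f ≤ B := by have := h 0 (by omega); rwa [nn_gj_zero] at this
    have h5 : B ≤ 4 ^ k * B := by
      have hB : 0 ≤ B := (nn_nonneg _ _).trans h4
      exact le_mul_of_one_le_left hB (one_le_pow₀ (by norm_num))
    rw [XX, pow_succ]; linarith

lemma SobSq_eq (ℓ : ℝ) (k : ℕ) (f : P3 → ℝ) :
    SobSq ℓ k f = ∑ j ∈ Finset.range (k + 1), nn ℓ (gj j f) ^ 2 := by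
  refine Finset.sum_congr rfl fun j _ => ?_
  rw [nn_sq]
  refine integral_congr_ae (Eventually.of_forall fun p => ?_)
  simp [gj, sq]

lemma SobSq_nonneg (ℓ : ℝ) (k : ℕ) (f : P3 → ℝ) : 0 ≤ SobSq ℓ k f := by
  rw [SobSq_eq]; exact Finset.sum_nonneg fun _ _ => sq_nonneg _

lemma sqrt_SobSq_le {ℓ : ℝ} (k : ℕ) {f : P3 → ℝ} (hf : Sm f) :
    Real.sqrt (SobSq ℓ k f) ≤ (k + 1) * XX ℓ k f := by
  refine Real.sqrt_le_iff.2 ⟨mul_nonneg (by positivity) (XX_nonneg _ _ _), ?_⟩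
  rw [SobSq_eq]
  refine (Finset.sum_le_card_nsmul _ _ (XX ℓ k f ^ 2) fun j hj => ?_).trans ?_
  · have hj : j ≤ k := by have := Finset.mem_range.1 hj; omega
    have := (nn_gj_le (ℓ := ℓ) j hf).trans (XX_mono hj f)
    exact pow_le_pow_left₀ (nn_nonneg _ _) this 2
  · simp only [Finset.card_range, nsmul_eq_mul, Nat.cast_add, Nat.cast_one]
    have h1 : (0:ℝ) ≤ k := Nat.cast_nonneg k
    have h2 := sq_nonneg (XX ℓ k f)
    rw [mul_pow]
    exact mul_le_mul_of_nonneg_right (by nlinarith) h2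

lemma XX_le_sqrt {ℓ : ℝ} (k : ℕ) {f : P3 → ℝ} (hf : Sm f) :
    XX ℓ k f ≤ 4 ^ k * Real.sqrt (SobSq ℓ k f) := by
  refine XX_le_gj k hf fun j hj => ?_
  refine Real.le_sqrt_of_sq_le ?_
  rw [SobSq_eq]
  exact Finset.single_le_sum (f := fun j => nn ℓ (gj j f) ^ 2) (fun _ _ => sq_nonneg _)
    (Finset.mem_range.2 (by omega))


/-! ## Divergence theorem on the disk -/

lemma disk_polar {F : ℝ × ℝ → ℝ} (hF : Continuous F) :
    ∫ y in disk, F y = ∫ r in (0:ℝ)..1, ∫ θ in (-π)..π, r * F (r * cos θ, r * sin θ) := by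
  have hpi : -π ≤ π := by linarith [pi_pos]
  rw [← integral_indicator disk_closed.measurableSet, ← integral_comp_polarCoord_symm]
  have hc : Continuous fun p : ℝ × ℝ => p.1 * F (p.1 * cos p.2, p.1 * sin p.2) := by fun_prop
  have e : ∀ p ∈ polarCoord.target, p.1 • Set.indicator disk F (polarCoord.symm p) =
      Set.indicator (Set.Ioc 0 1 ×ˢ Set.Ioo (-π) π)
        (fun p : ℝ × ℝ => p.1 * F (p.1 * cos p.2, p.1 * sin p.2)) p := by
    rintro ⟨r, θ⟩ hp
    rw [polarCoord_target] at hp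
    have hr : 0 < r := hp.1
    have hθ : θ ∈ Set.Ioo (-π) π := hp.2
    have hm : polarCoord.symm (r, θ) ∈ disk ↔ (r, θ) ∈ Set.Ioc (0:ℝ) 1 ×ˢ Set.Ioo (-π) π := by
      simp only [polarCoord_symm_apply, disk, Set.mem_ofPred_eq, Set.mem_prod, hθ, and_true, Set.mem_Ioc, hr, true_and]
      have : (r * cos θ) ^ 2 + (r * sin θ) ^ 2 = r ^ 2 := by
        have := sin_sq_add_cos_sq θ
        linear_combination r ^ 2 * this
      rw [this]; constructor <;> intro h <;> nlinarith
    by_cases h : polarCoord.symm (r, θ) ∈ disk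
    · rw [Set.indicator_of_mem h, Set.indicator_of_mem (hm.1 h)]; simp
    · rw [Set.indicator_of_notMem h, Set.indicator_of_notMem (mt hm.2 h)]; simp
  rw [setIntegral_congr_fun polarCoord.open_target.measurableSet e,
    setIntegral_indicator (measurableSet_Ioc.prod measurableSet_Ioo)]
  have e2 : polarCoord.target ∩ Set.Ioc (0:ℝ) 1 ×ˢ Set.Ioo (-π) π = Set.Ioc (0:ℝ) 1 ×ˢ Set.Ioo (-π) π := by
    rw [polarCoord_target]
    exact Set.inter_eq_right.2 (Set.prod_mono (fun x hx => hx.1) le_rfl)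
  rw [e2, intervalIntegral.integral_of_le zero_le_one]
  rw [Measure.volume_eq_prod, setIntegral_prod _ ?_]
  · refine setIntegral_congr_fun measurableSet_Ioc fun r _ => ?_
    dsimp only
    rw [intervalIntegral.integral_of_le hpi, integral_Ioc_eq_integral_Ioo]
  · exact (hc.continuousOn.integrableOn_compact (isCompact_Icc.prod isCompact_Icc)).mono_set
      (Set.prod_mono Set.Ioc_subset_Icc_self Set.Ioo_subset_Icc_self)

lemma swap_cont {A : ℝ → ℝ → ℝ} (hA : Continuous (Function.uncurry A)) {a b c d : ℝ} (hab : a ≤ b) (hcd : c ≤ d) :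
    ∫ r in a..b, ∫ θ in c..d, A r θ = ∫ θ in c..d, ∫ r in a..b, A r θ := by
  simp only [intervalIntegral.integral_of_le hab, intervalIntegral.integral_of_le hcd]
  refine integral_integral_swap ?_
  rw [Measure.prod_restrict]
  exact (hA.continuousOn.integrableOn_compact (isCompact_Icc.prod isCompact_Icc)).mono_set
      (Set.prod_mono Set.Ioc_subset_Icc_self Set.Ioc_subset_Icc_self)

section
variable {g : ℝ × ℝ → ℝ}

lemma fd_lin (y : ℝ × ℝ) (u v : ℝ) :
    fderiv ℝ g y (u, v) = u * fderiv ℝ g y (1, 0) + v * fderiv ℝ g y (0, 1) := by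
  have : ((u, v) : ℝ × ℝ) = u • (1, 0) + v • (0, 1) := by ext <;> simp
  rw [this, map_add, map_smul, map_smul]; simp

def polA (g : ℝ × ℝ → ℝ) (a b r θ : ℝ) : ℝ :=
  (a * cos θ + b * sin θ) * g (r * cos θ, r * sin θ) + r * (a * cos θ + b * sin θ) *
        (cos θ * fderiv ℝ g (r * cos θ, r * sin θ) (1, 0) + sin θ * fderiv ℝ g (r * cos θ, r * sin θ) (0, 1))
def polB (g : ℝ × ℝ → ℝ) (a b r θ : ℝ) : ℝ :=
  (-(b * sin θ) - a * cos θ) * g (r * cos θ, r * sin θ) + (b * cos θ - a * sin θ) *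
        (-(r * sin θ) * fderiv ℝ g (r * cos θ, r * sin θ) (1, 0) + r * cos θ * fderiv ℝ g (r * cos θ, r * sin θ) (0, 1))

lemma polA_deriv (hd : Differentiable ℝ g) (a b r θ : ℝ) :
    HasDerivAt (fun r => r * (a * cos θ + b * sin θ) * g (r * cos θ, r * sin θ)) (polA g a b r θ) r := by
  have h1 : HasDerivAt (fun r : ℝ => (r * cos θ, r * sin θ)) (cos θ, sin θ) r := by
    simpa using ((hasDerivAt_id r).mul_const (cos θ)).prodMk ((hasDerivAt_id r).mul_const (sin θ))
  have h2 := (hd (r * cos θ, r * sin θ)).hasFDerivAt.comp_hasDerivAt r h1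
  have h3 := ((hasDerivAt_id r).mul_const (a * cos θ + b * sin θ)).mul h2
  refine HasDerivAt.congr_deriv h3 ?_
  rw [fd_lin]
  simp [polA]

lemma polB_deriv (hd : Differentiable ℝ g) (a b r θ : ℝ) :
    HasDerivAt (fun θ => (b * cos θ - a * sin θ) * g (r * cos θ, r * sin θ)) (polB g a b r θ) θ := by
  have h1 : HasDerivAt (fun θ : ℝ => (r * cos θ, r * sin θ)) (-(r * sin θ), r * cos θ) θ := by
    simpa using ((hasDerivAt_cos θ).const_mul r).prodMk ((hasDerivAt_sin θ).const_mul r)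
  have h2 := (hd (r * cos θ, r * sin θ)).hasFDerivAt.comp_hasDerivAt θ h1
  have h3 := (((hasDerivAt_cos θ).const_mul b).sub ((hasDerivAt_sin θ).const_mul a)).mul h2
  refine HasDerivAt.congr_deriv h3 ?_
  rw [fd_lin]
  simp [polB]

lemma pol_sum (a b r θ : ℝ) :
    r * fderiv ℝ g (r * cos θ, r * sin θ) (a, b) = polA g a b r θ + polB g a b r θ := by
  rw [fd_lin]
  generalize hu : fderiv ℝ g (r * cos θ, r * sin θ) (1, 0) = u
  generalize hv : fderiv ℝ g (r * cos θ, r * sin θ) (0, 1) = v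
  simp only [polA, polB, hu, hv]
  have hs := sin_sq_add_cos_sq θ
  linear_combination (-(r * a * u) - r * b * v) * hs

lemma polA_cont (hg : Continuous g) (h1 : Continuous fun y => fderiv ℝ g y (1, 0))
    (h2 : Continuous fun y => fderiv ℝ g y (0, 1)) (a b : ℝ) :
    Continuous (Function.uncurry (polA g a b)) := by
  have hp : Continuous fun q : ℝ × ℝ => (q.1 * cos q.2, q.1 * sin q.2) := by fun_prop
  have e0 := hg.comp hp
  have e1 := h1.comp hp
  have e2 := h2.comp hp
  simp only [Function.comp_def] at e0 e1 e2
  simp only [Function.uncurry_def, polA]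
  fun_prop

lemma polB_cont (hg : Continuous g) (h1 : Continuous fun y => fderiv ℝ g y (1, 0))
    (h2 : Continuous fun y => fderiv ℝ g y (0, 1)) (a b : ℝ) :
    Continuous (Function.uncurry (polB g a b)) := by
  have hp : Continuous fun q : ℝ × ℝ => (q.1 * cos q.2, q.1 * sin q.2) := by fun_prop
  have e0 := hg.comp hp
  have e1 := h1.comp hp
  have e2 := h2.comp hp
  simp only [Function.comp_def] at e0 e1 e2
  simp only [Function.uncurry_def, polB]
  fun_prop

lemma disk_div (hg : ContDiff ℝ 1 g) (a b : ℝ) :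
    ∫ y in disk, fderiv ℝ g y (a, b) =
      ∫ θ in (-π)..π, (a * cos θ + b * sin θ) * g (cos θ, sin θ) := by
  have hfd : Continuous (fderiv ℝ g) := hg.continuous_fderiv (by simp)
  have hgc : Continuous g := hg.continuous
  have hd : Differentiable ℝ g := hg.differentiable (by simp)
  have hpi : -π ≤ π := by linarith [pi_pos]
  have hfv : ∀ v : ℝ × ℝ, Continuous fun y => fderiv ℝ g y v := fun v => hfd.clm_apply continuous_const
  have hpol := disk_polar (F := fun y => fderiv ℝ g y (a, b)) (hfv _)
  have hAc := polA_cont hgc (hfv _) (hfv _) a b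
  have hBc := polB_cont hgc (hfv _) (hfv _) a b
  have hAr : ∀ θ, Continuous fun r => polA g a b r θ := fun θ => hAc.uncurry_right θ
  have hAθ : ∀ r, Continuous (polA g a b r) := fun r => hAc.uncurry_left r
  have hBθ : ∀ r, Continuous (polB g a b r) := fun r => hBc.uncurry_left r
  have hB0 : ∀ r, ∫ θ in (-π)..π, polB g a b r θ = 0 := by
    intro r
    rw [intervalIntegral.integral_eq_sub_of_hasDerivAt (fun θ _ => polB_deriv hd a b r θ) ((hBθ r).intervalIntegrable _ _)]
    simp
  have step : ∀ r, ∫ θ in (-π)..π, r * fderiv ℝ g (r * cos θ, r * sin θ) (a, b) = ∫ θ in (-π)..π, polA g a b r θ := by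
    intro r
    simp only [pol_sum]
    rw [intervalIntegral.integral_add ((hAθ r).intervalIntegrable _ _) ((hBθ r).intervalIntegrable _ _), hB0, add_zero]
  have step2 : ∀ θ, ∫ r in (0:ℝ)..1, polA g a b r θ = (a * cos θ + b * sin θ) * g (cos θ, sin θ) := by
    intro θ
    rw [intervalIntegral.integral_eq_sub_of_hasDerivAt (fun r _ => polA_deriv hd a b r θ) ((hAr θ).intervalIntegrable _ _)]
    simp
  have hsw := swap_cont hAc zero_le_one hpi
  simp only [step2] at hsw
  simp only [step] at hpol
  rw [hpol, hsw]

end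


/-! ## Integration by parts on the solid torus -/

lemma II_fub {ℓ : ℝ} {f : P3 → ℝ} (hf : Continuous f) :
    II ℓ f = ∫ α in Set.Ioc 0 ℓ, ∫ y in disk, f (α, y) := by
  have h : IntegrableOn f (Set.Ioc 0 ℓ ×ˢ disk) (volume.prod volume) := intOn hf
  rw [II, domP_eq, Measure.volume_eq_prod, setIntegral_prod _ h]

lemma II_fub' {ℓ : ℝ} {f : P3 → ℝ} (hf : Continuous f) :
    II ℓ f = ∫ y in disk, ∫ α in Set.Ioc 0 ℓ, f (α, y) := by
  rw [II, domP_eq, Measure.volume_eq_prod, ← Measure.prod_restrict]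
  refine integral_prod_symm _ ?_
  rw [Measure.prod_restrict]
  exact intOn hf

/-- boundary integral -/
def BB (ℓ : ℝ) (f : P3 → ℝ) : ℝ :=
  ∫ α in Set.Ioc 0 ℓ, ∫ θ in Set.Ioc (-π) π, f (α, cos θ, sin θ)

def bμ (ℓ : ℝ) : Measure (ℝ × ℝ) := (volume : Measure (ℝ × ℝ)).restrict (Set.Ioc 0 ℓ ×ˢ Set.Ioc (-π) π)

lemma bμ_int {ℓ : ℝ} {f : P3 → ℝ} (hf : Continuous f) :
    Integrable (fun q : ℝ × ℝ => f (q.1, cos q.2, sin q.2)) (bμ ℓ) := by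
  have hc : Continuous (fun q : ℝ × ℝ => f (q.1, cos q.2, sin q.2)) := by fun_prop
  exact (hc.continuousOn.integrableOn_compact (isCompact_Icc.prod isCompact_Icc)).mono_set
      (Set.prod_mono Set.Ioc_subset_Icc_self Set.Ioc_subset_Icc_self)

lemma BB_eq {ℓ : ℝ} {f : P3 → ℝ} (hf : Continuous f) :
    BB ℓ f = ∫ q, f (q.1, cos q.2, sin q.2) ∂(bμ ℓ) := by
  have := bμ_int (ℓ := ℓ) hf
  rw [bμ, Measure.volume_eq_prod] at *
  rw [setIntegral_prod _ this]; rfl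

lemma BB_add {ℓ : ℝ} {f g : P3 → ℝ} (hf : Continuous f) (hg : Continuous g) :
    BB ℓ (f + g) = BB ℓ f + BB ℓ g := by
  rw [BB_eq hf, BB_eq hg, BB_eq (hf.add hg)]
  exact integral_add (bμ_int hf) (bμ_int hg)

lemma BB_sub {ℓ : ℝ} {f g : P3 → ℝ} (hf : Continuous f) (hg : Continuous g) :
    BB ℓ (f - g) = BB ℓ f - BB ℓ g := by
  rw [BB_eq hf, BB_eq hg, BB_eq (hf.sub hg)]
  exact integral_sub (bμ_int hf) (bμ_int hg)

lemma BB_congr {ℓ : ℝ} {f g : P3 → ℝ}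
    (h : ∀ p : P3, p.2.1 ^ 2 + p.2.2 ^ 2 = 1 → f p = g p) : BB ℓ f = BB ℓ g := by
  have : ∀ α θ : ℝ, f (α, cos θ, sin θ) = g (α, cos θ, sin θ) := fun α θ => h _ (by simp)
  simp only [BB, this]

lemma BB_nonneg {ℓ : ℝ} {f : P3 → ℝ} (h : ∀ p : P3, 0 ≤ f p) : 0 ≤ BB ℓ f :=
  integral_nonneg fun α => integral_nonneg fun θ => h _

lemma BB_zero (ℓ : ℝ) : BB ℓ 0 = 0 := by simp [BB]

lemma fiber_fderiv {h : P3 → ℝ} (hh : Sm h) (α : ℝ) (y : ℝ × ℝ) (a b : ℝ) :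
    fderiv ℝ (fun y : ℝ × ℝ => h (α, y)) y (a, b) = fderiv ℝ h (α, y) (0, a, b) := by
  have h1 : HasFDerivAt (fun y : ℝ × ℝ => (α, y)) (ContinuousLinearMap.inr ℝ ℝ (ℝ × ℝ)) y :=
    hasFDerivAt_prodMk_right α y
  have h2 := (hh.diff (α, y)).hasFDerivAt.comp y h1
  have h3 := h2.fderiv
  simp only [Function.comp_def] at h3
  rw [h3]; simp

lemma fiber_div {h : P3 → ℝ} (hh : Sm h) (α a b : ℝ) :
    ∫ y in disk, fderiv ℝ h (α, y) (0, a, b) =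
      ∫ θ in Set.Ioc (-π) π, (a * cos θ + b * sin θ) * h (α, cos θ, sin θ) := by
  have hg : ContDiff ℝ 1 (fun y : ℝ × ℝ => h (α, y)) :=
    (ContDiff.comp hh (contDiff_const.prodMk contDiff_id)).of_le (by exact WithTop.coe_le_coe.2 le_top)
  have := disk_div hg a b
  simp only [fiber_fderiv hh] at this
  rw [this, intervalIntegral.integral_of_le (by linarith [pi_pos])]

lemma II_p1 {ℓ : ℝ} {h : P3 → ℝ} (hh : Sm h) : II ℓ (p1 h) = BB ℓ (y1 * h) := by
  rw [II_fub hh.p1.cont, BB]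
  congr 1; ext α
  have := fiber_div hh α 1 0
  simp only [one_mul, zero_mul, add_zero] at this
  exact this

lemma II_p2 {ℓ : ℝ} {h : P3 → ℝ} (hh : Sm h) : II ℓ (p2 h) = BB ℓ (y2 * h) := by
  rw [II_fub hh.p2.cont, BB]
  congr 1; ext α
  have := fiber_div hh α 0 1
  simp only [one_mul, zero_mul, zero_add] at this
  exact this

lemma hasDerivAt_alpha {h : P3 → ℝ} (hh : Sm h) (α : ℝ) (y : ℝ × ℝ) :
    HasDerivAt (fun α => h (α, y)) (pA h (α, y)) α := by
  have h1 : HasDerivAt (fun α : ℝ => (α, y)) (1, 0) α :=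
    (hasDerivAt_id α).prodMk (hasDerivAt_const α y)
  exact (hh.diff (α, y)).hasFDerivAt.comp_hasDerivAt α h1

lemma alpha_ftc {h : P3 → ℝ} (hh : Sm h) (a b : ℝ) (y : ℝ × ℝ) :
    ∫ α in a..b, pA h (α, y) = h (b, y) - h (a, y) := by
  refine intervalIntegral.integral_eq_sub_of_hasDerivAt (fun α _ => hasDerivAt_alpha hh α y) ?_
  have : Continuous fun α => pA h (α, y) := hh.pA.cont.comp (by fun_prop)
  exact this.intervalIntegrable _ _

lemma II_pA {ℓ : ℝ} (hℓ : 0 < ℓ) {h : P3 → ℝ} (hh : Sm h) (hp : PerA ℓ h) : II ℓ (pA h) = 0 := by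
  rw [II_fub' hh.pA.cont]
  simp only [← intervalIntegral.integral_of_le hℓ.le, alpha_ftc hh]
  have : ∀ y : ℝ × ℝ, h (ℓ, y) - h (0, y) = 0 := by
    intro y
    have := hp (0, y)
    simp only [zero_add] at this
    rw [← this]; simp
  simp [this]

lemma circ_deriv {h : P3 → ℝ} (hh : Sm h) (h0 : ∀ p : P3, p.2.1 ^ 2 + p.2.2 ^ 2 = 1 → h p = 0)
    (p : P3) (hp : p.2.1 ^ 2 + p.2.2 ^ 2 = 1) : p.2.1 * p2 h p - p.2.2 * p1 h p = 0 := by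
  obtain ⟨α, u, v⟩ := p
  simp only at hp ⊢
  have hq : HasDerivAt (fun s : ℝ => ((α, u * cos s - v * sin s, v * cos s + u * sin s) : P3)) (0, -v, u) 0 := by
    have c := hasDerivAt_cos 0
    have s := hasDerivAt_sin 0
    have := (hasDerivAt_const (0:ℝ) α).prodMk (((c.const_mul u).sub (s.const_mul v)).prodMk ((c.const_mul v).add (s.const_mul u)))
    refine HasDerivAt.congr_deriv this ?_
    simp
  have e0 : ((α, u * cos 0 - v * sin 0, v * cos 0 + u * sin 0) : P3) = (α, u, v) := by simp
  have hd : HasFDerivAt h (fderiv ℝ h (α, u, v)) (α, u * cos 0 - v * sin 0, v * cos 0 + u * sin 0) := by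
    rw [e0]; exact (hh.diff _).hasFDerivAt
  have h1 := hd.comp_hasDerivAt (0:ℝ) hq
  have h2 : (h ∘ fun s : ℝ => ((α, u * cos s - v * sin s, v * cos s + u * sin s) : P3)) = fun _ => 0 := by
    ext s
    refine h0 _ ?_
    simp only
    linear_combination (u ^ 2 + v ^ 2) * sin_sq_add_cos_sq s + hp
  rw [h2] at h1
  have h3 := h1.unique (hasDerivAt_const (0:ℝ) (0:ℝ))
  have e : ((0, -v, u) : P3) = (-v) • (0, 1, 0) + u • (0, 0, 1) := by ext <;> simp
  rw [e, map_add, map_smul, map_smul] at h3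
  simp only [smul_eq_mul] at h3
  simp only [p1, p2]; linarith

lemma tang_deriv {v1 v2 : P3 → ℝ} (h1 : Sm v1) (h2 : Sm v2) (ht : TangentP v1 v2)
    (p : P3) (hp : p.2.1 ^ 2 + p.2.2 ^ 2 = 1) :
    p.2.1 * v2 p - p.2.2 * v1 p + p.2.1 * (p.2.1 * p2 v1 p - p.2.2 * p1 v1 p)
      + p.2.2 * (p.2.1 * p2 v2 p - p.2.2 * p1 v2 p) = 0 := by
  have := circ_deriv ((sm_y1.mul' h1).add' (sm_y2.mul' h2)) (fun q hq => ht q hq) p hp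
  rw [p1_eq, p2_eq, dv_add _ (sm_y1.mul' h1) (sm_y2.mul' h2), dv_add _ (sm_y1.mul' h1) (sm_y2.mul' h2),
    ← p1_eq, ← p2_eq, p1_y1 h1, p1_y2 h2, p2_y1 h1, p2_y2 h2] at this
  simp only [Pi.add_apply, Pi.mul_apply, y1, y2] at this
  linarith

lemma p1_mul {f g : P3 → ℝ} (hf : Sm f) (hg : Sm g) : p1 (f * g) = p1 f * g + f * p1 g := dv_mul _ hf hg
lemma p2_mul {f g : P3 → ℝ} (hf : Sm f) (hg : Sm g) : p2 (f * g) = p2 f * g + f * p2 g := dv_mul _ hf hg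
lemma pA_mul {f g : P3 → ℝ} (hf : Sm f) (hg : Sm g) : pA (f * g) = pA f * g + f * pA g := dv_mul _ hf hg

lemma energy2 {ℓ : ℝ} {v1 v2 : P3 → ℝ} (h1 : Sm v1) (h2 : Sm v2) (ht : TangentP v1 v2) :
    II ℓ ((p1 v1 + p2 v2) * (p1 v1 + p2 v2) + (p1 v2 - p2 v1) * (p1 v2 - p2 v1)) =
      II ℓ (p1 v1 * p1 v1 + p2 v1 * p2 v1 + (p1 v2 * p1 v2 + p2 v2 * p2 v2)) +
        BB ℓ (v1 * v1 + v2 * v2) := by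
  have s1 := h1.mul' h2.p2
  have s2 := h1.mul' h2.p1
  have s3 := h2.mul' h1.p2
  have s4 := h2.mul' h1.p1
  have c1 := h1.p1.cont; have c2 := h1.p2.cont; have c3 := h2.p1.cont; have c4 := h2.p2.cont
  have c0 := h1.cont; have c0' := h2.cont
  have k1 := s1.p1.cont; have k2 := s2.p2.cont; have k3 := s3.p1.cont; have k4 := s4.p2.cont
  have cy1 := sm_y1.cont; have cy2 := sm_y2.cont
  have e : (p1 v1 + p2 v2) * (p1 v1 + p2 v2) + (p1 v2 - p2 v1) * (p1 v2 - p2 v1) =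
      (p1 v1 * p1 v1 + p2 v1 * p2 v1 + (p1 v2 * p1 v2 + p2 v2 * p2 v2)) +
      ((p1 (v1 * p2 v2) - p2 (v1 * p1 v2)) - (p1 (v2 * p2 v1) - p2 (v2 * p1 v1))) := by
    rw [p1_mul h1 h2.p2, p2_mul h1 h2.p1, p1_mul h2 h1.p2, p2_mul h2 h1.p1, p1_p2 h1, p1_p2 h2]
    ring
  rw [e, II_add (by fun_prop) (by fun_prop), II_sub (by fun_prop) (by fun_prop),
    II_sub (by fun_prop) (by fun_prop), II_sub (by fun_prop) (by fun_prop), II_p1 s1, II_p2 s2, II_p1 s3, II_p2 s4,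
    ← BB_sub (by fun_prop) (by fun_prop), ← BB_sub (by fun_prop) (by fun_prop), ← BB_sub (by fun_prop) (by fun_prop)]
  congr 1
  refine BB_congr fun p hp => ?_
  have t0 := ht p hp
  have t1 := tang_deriv h1 h2 ht p hp
  simp only [Pi.add_apply, Pi.mul_apply, Pi.sub_apply, y1, y2]
  generalize p.2.1 = u at *
  generalize p.2.2 = v at *
  generalize v1 p = a at *
  generalize v2 p = b at *
  have ha : a = -v * (u * b - v * a) := by linear_combination u * t0 - a * hp
  have hb : b = u * (u * b - v * a) := by linear_combination v * t0 - b * hp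
  generalize hτ : u * b - v * a = τ at *
  generalize p1 v1 p = m1 at *
  generalize p2 v1 p = m2 at *
  generalize p1 v2 p = m3 at *
  generalize p2 v2 p = m4 at *
  rw [ha, hb]
  linear_combination (-τ) * t1 - τ * τ * hp

lemma poincare_bd {ℓ : ℝ} {h : P3 → ℝ} (hh : Sm h) :
    II ℓ (h * h) ≤ BB ℓ (h * h) + II ℓ (p1 h * p1 h + p2 h * p2 h) := by
  have c0 := hh.cont; have c1 := hh.p1.cont; have c2 := hh.p2.cont
  have cy1 := sm_y1.cont; have cy2 := sm_y2.cont
  have s := hh.mul' hh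
  have s1 := (sm_y1.mul' s); have s2 := (sm_y2.mul' s)
  have k1 := s1.p1.cont; have k2 := s2.p2.cont
  have hB : BB ℓ (h * h) = II ℓ (p1 (y1 * (h * h)) + p2 (y2 * (h * h))) := by
    rw [II_add (by fun_prop) (by fun_prop), II_p1 s1, II_p2 s2, ← BB_add (by fun_prop) (by fun_prop)]
    refine BB_congr fun p hp => ?_
    simp only [Pi.add_apply, Pi.mul_apply, y1, y2]
    linear_combination (-(h p * h p)) * hp
  rw [hB, ← II_add (by fun_prop) (by fun_prop)]
  refine II_mono (by fun_prop) (by fun_prop) fun p hp => ?_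
  rw [p1_y1 s, p2_y2 s, p1_mul hh hh, p2_mul hh hh]
  simp only [Pi.add_apply, Pi.mul_apply, y1, y2]
  generalize p.2.1 = u at *
  generalize p.2.2 = v at *
  generalize h p = a
  generalize p1 h p = b
  generalize p2 h p = c
  nlinarith [sq_nonneg (a + (u * b + v * c)), sq_nonneg (u * c - v * b), mul_nonneg (sub_nonneg.2 hp) (add_nonneg (sq_nonneg b) (sq_nonneg c))]

lemma base_est {ℓ : ℝ} {v1 v2 : P3 → ℝ} (h1 : Sm v1) (h2 : Sm v2) (ht : TangentP v1 v2) :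
    YY ℓ 1 v1 + YY ℓ 1 v2 ≤ 12 * (nn ℓ (p1 v1 + p2 v2) + nn ℓ (p1 v2 - p2 v1)) := by
  have c1 := h1.p1.cont; have c2 := h1.p2.cont; have c3 := h2.p1.cont; have c4 := h2.p2.cont
  have c0 := h1.cont; have c0' := h2.cont
  have e := energy2 (ℓ := ℓ) h1 h2 ht
  have q1 := poincare_bd (ℓ := ℓ) h1
  have q2 := poincare_bd (ℓ := ℓ) h2
  have b1 : 0 ≤ BB ℓ (v1 * v1) := BB_nonneg fun p => mul_self_nonneg _
  have b2 : 0 ≤ BB ℓ (v2 * v2) := BB_nonneg fun p => mul_self_nonneg _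
  rw [II_add (by fun_prop) (by fun_prop), II_add (by fun_prop) (by fun_prop), II_add (by fun_prop) (by fun_prop),
    II_add (by fun_prop) (by fun_prop), BB_add (by fun_prop) (by fun_prop)] at e
  rw [II_add (by fun_prop) (by fun_prop)] at q1 q2
  simp only [← nn_sq] at e q1 q2
  simp only [YY]
  have n1 := nn_nonneg ℓ (p1 v1 + p2 v2)
  have n2 := nn_nonneg ℓ (p1 v2 - p2 v1)
  set R := nn ℓ (p1 v1 + p2 v2) + nn ℓ (p1 v2 - p2 v1) with hR
  have hRR : nn ℓ (p1 v1 + p2 v2) ^ 2 + nn ℓ (p1 v2 - p2 v1) ^ 2 ≤ R ^ 2 := by rw [hR]; nlinarith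
  have hR0 : 0 ≤ R := by positivity
  have key : ∀ x : ℝ, x ^ 2 ≤ 2 * R ^ 2 → x ≤ 2 * R := fun x hx =>
    le_of_sq_le_sq'' (by nlinarith [sq_nonneg R]) (by positivity)
  have := key (nn ℓ v1) (by nlinarith [sq_nonneg (nn ℓ (p1 v1)), sq_nonneg (nn ℓ (p1 v2)), sq_nonneg (nn ℓ (p2 v1)), sq_nonneg (nn ℓ (p2 v2))])
  have := key (nn ℓ v2) (by nlinarith [sq_nonneg (nn ℓ (p1 v1)), sq_nonneg (nn ℓ (p1 v2)), sq_nonneg (nn ℓ (p2 v1)), sq_nonneg (nn ℓ (p2 v2))])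
  have := key (nn ℓ (p1 v1)) (by nlinarith [sq_nonneg (nn ℓ (p1 v1)), sq_nonneg (nn ℓ (p1 v2)), sq_nonneg (nn ℓ (p2 v1)), sq_nonneg (nn ℓ (p2 v2))])
  have := key (nn ℓ (p1 v2)) (by nlinarith [sq_nonneg (nn ℓ (p1 v1)), sq_nonneg (nn ℓ (p1 v2)), sq_nonneg (nn ℓ (p2 v1)), sq_nonneg (nn ℓ (p2 v2))])
  have := key (nn ℓ (p2 v1)) (by nlinarith [sq_nonneg (nn ℓ (p1 v1)), sq_nonneg (nn ℓ (p1 v2)), sq_nonneg (nn ℓ (p2 v1)), sq_nonneg (nn ℓ (p2 v2))])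
  have := key (nn ℓ (p2 v2)) (by nlinarith [sq_nonneg (nn ℓ (p1 v1)), sq_nonneg (nn ℓ (p1 v2)), sq_nonneg (nn ℓ (p2 v1)), sq_nonneg (nn ℓ (p2 v2))])
  linarith


/-! ## Higher order two-dimensional div-curl estimate -/

lemma p1_add {f g : P3 → ℝ} (hf : Sm f) (hg : Sm g) : p1 (f + g) = p1 f + p1 g := dv_add _ hf hg
lemma p2_add {f g : P3 → ℝ} (hf : Sm f) (hg : Sm g) : p2 (f + g) = p2 f + p2 g := dv_add _ hf hg
lemma pA_add {f g : P3 → ℝ} (hf : Sm f) (hg : Sm g) : pA (f + g) = pA f + pA g := dv_add _ hf hg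
lemma p1_sub {f g : P3 → ℝ} (hf : Sm f) (hg : Sm g) : p1 (f - g) = p1 f - p1 g := dv_sub _ hf hg
lemma p2_sub {f g : P3 → ℝ} (hf : Sm f) (hg : Sm g) : p2 (f - g) = p2 f - p2 g := dv_sub _ hf hg
lemma pA_sub {f g : P3 → ℝ} (hf : Sm f) (hg : Sm g) : pA (f - g) = pA f - pA g := dv_sub _ hf hg

/-- multiplication by `1 - r²` -/
def ph (f : P3 → ℝ) : P3 → ℝ := f - y1 * (y1 * f) - y2 * (y2 * f)
/-- angular derivative -/
def th (f : P3 → ℝ) : P3 → ℝ := y1 * p2 f - y2 * p1 f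

lemma Sm.ph {f : P3 → ℝ} (hf : Sm f) : Sm (ph f) :=
  (hf.sub' (sm_y1.mul' (sm_y1.mul' hf))).sub' (sm_y2.mul' (sm_y2.mul' hf))
lemma Sm.th {f : P3 → ℝ} (hf : Sm f) : Sm (th f) :=
  (sm_y1.mul' hf.p2).sub' (sm_y2.mul' hf.p1)

lemma p1_ph {f : P3 → ℝ} (hf : Sm f) : p1 (ph f) = ph (p1 f) - (2 : ℝ) • (y1 * f) := by
  have a := sm_y1.mul' hf; have a2 := sm_y1.mul' a
  have b := sm_y2.mul' hf; have b2 := sm_y2.mul' b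
  rw [ph, p1_sub (hf.sub' a2) b2, p1_sub hf a2, p1_y1 a, p1_y1 hf, p1_y2 b, p1_y2 hf, ph]
  ext p; simp; ring
lemma p2_ph {f : P3 → ℝ} (hf : Sm f) : p2 (ph f) = ph (p2 f) - (2 : ℝ) • (y2 * f) := by
  have a := sm_y1.mul' hf; have a2 := sm_y1.mul' a
  have b := sm_y2.mul' hf; have b2 := sm_y2.mul' b
  rw [ph, p2_sub (hf.sub' a2) b2, p2_sub hf a2, p2_y1 a, p2_y1 hf, p2_y2 b, p2_y2 hf, ph]
  ext p; simp; ring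
lemma p1_th {f : P3 → ℝ} (hf : Sm f) : p1 (th f) = th (p1 f) + p2 f := by
  rw [th, p1_sub (sm_y1.mul' hf.p2) (sm_y2.mul' hf.p1), p1_y1 hf.p2, p1_y2 hf.p1, th, p1_p2 hf]
  ext p; simp; ring
lemma p2_th {f : P3 → ℝ} (hf : Sm f) : p2 (th f) = th (p2 f) - p1 f := by
  rw [th, p2_sub (sm_y1.mul' hf.p2) (sm_y2.mul' hf.p1), p2_y1 hf.p2, p2_y2 hf.p1, th, p1_p2 hf]
  ext p; simp; ring

lemma YY_ph {ℓ : ℝ} (b : ℕ) {f : P3 → ℝ} (hf : Sm f) :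
    YY ℓ b (ph f) ≤ (1 + 2 * (b + 1) ^ 2) * YY ℓ b f := by
  have a := sm_y1.mul' hf; have a2 := sm_y1.mul' a
  have c := sm_y2.mul' hf; have c2 := sm_y2.mul' c
  have h1 := YY_sub (ℓ := ℓ) b (hf.sub' a2) c2
  have h2 := YY_sub (ℓ := ℓ) b hf a2
  have h3 := YY_y1 (ℓ := ℓ) b a
  have h4 := YY_y1 (ℓ := ℓ) b hf
  have h5 := YY_y2 (ℓ := ℓ) b c
  have h6 := YY_y2 (ℓ := ℓ) b hf
  have hb : (0 : ℝ) ≤ b + 1 := by positivity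
  have h7 := mul_le_mul_of_nonneg_left h4 hb
  have h8 := mul_le_mul_of_nonneg_left h6 hb
  rw [ph]; nlinarith

lemma YY_th {ℓ : ℝ} (b : ℕ) {f : P3 → ℝ} (hf : Sm f) :
    YY ℓ b (th f) ≤ 2 * (b + 1) * YY ℓ (b + 1) f := by
  have h1 := YY_sub (ℓ := ℓ) b (sm_y1.mul' hf.p2) (sm_y2.mul' hf.p1)
  have h3 := YY_y1 (ℓ := ℓ) b hf.p2
  have h4 := YY_y2 (ℓ := ℓ) b hf.p1
  have hb : (0 : ℝ) ≤ b + 1 := by positivity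
  have h7 := mul_le_mul_of_nonneg_left (YY_p1 (ℓ := ℓ) b f) hb
  have h8 := mul_le_mul_of_nonneg_left (YY_p2 (ℓ := ℓ) b f) hb
  rw [th]; linarith

lemma ph_tang (f g : P3 → ℝ) : TangentP (ph f) (ph g) := by
  intro p hp
  have h : 1 - p.2.1 ^ 2 - p.2.2 ^ 2 = 0 := by linarith
  have e : ∀ f : P3 → ℝ, ph f p = (1 - p.2.1 ^ 2 - p.2.2 ^ 2) * f p := by
    intro f; simp [ph, y1, y2]; ring
  rw [e, e, h]; ring

lemma sum_ph {f : P3 → ℝ} : f = ph f + y1 * (y1 * f) + y2 * (y2 * f) := by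
  ext p; simp only [ph, Pi.add_apply, Pi.sub_apply]; ring

/-- the step of the induction, with everything explicit -/
lemma ell_step {ℓ : ℝ} (b : ℕ) {K : ℝ} (hK : 0 ≤ K)
    (IH : ∀ w1 w2 : P3 → ℝ, Sm w1 → Sm w2 → TangentP w1 w2 →
      YY ℓ (b + 1) w1 + YY ℓ (b + 1) w2 ≤ K * (YY ℓ b (p1 w1 + p2 w2) + YY ℓ b (p1 w2 - p2 w1))) :
    ∃ K' : ℝ, 0 ≤ K' ∧ ∀ v1 v2 : P3 → ℝ, Sm v1 → Sm v2 → TangentP v1 v2 →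
      YY ℓ (b + 2) v1 + YY ℓ (b + 2) v2 ≤
        K' * (YY ℓ (b + 1) (p1 v1 + p2 v2) + YY ℓ (b + 1) (p1 v2 - p2 v1)) := by
  set m : ℝ := (b : ℝ) + 1 with hm
  set m' : ℝ := (b : ℝ) + 2 with hm'
  have hm0 : 0 ≤ m := by positivity
  have hm0' : 0 ≤ m' := by positivity
  set k0 : ℝ := K with hk0
  set k1 : ℝ := K * (2 * m) with hk1
  set k2 : ℝ := K * ((1 + 2 * m ^ 2) + 4 * m * k0) with hk2
  set k3 : ℝ := m' * (2 * m' + k1 + k0) + m' * (k1 + k0) with hk3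
  have h1 : 0 ≤ k1 := by positivity
  have h2 : 0 ≤ k2 := by positivity
  have h3 : 0 ≤ k3 := by positivity
  refine ⟨k0 + 2 * k2 + 4 * k3, by positivity, fun v1 v2 s1 s2 ht => ?_⟩
  set d := p1 v1 + p2 v2 with hd
  set c := p1 v2 - p2 v1 with hc
  have sd : Sm d := s1.p1.add' s2.p2
  have sc : Sm c := s2.p1.sub' s1.p2
  set S := YY ℓ (b + 1) d + YY ℓ (b + 1) c with hS
  have dn := YY_nonneg ℓ (b + 1) d
  have cn := YY_nonneg ℓ (b + 1) c
  -- zeroth bound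
  have e0 : YY ℓ (b + 1) v1 + YY ℓ (b + 1) v2 ≤ k0 * S :=
    (IH v1 v2 s1 s2 ht).trans (mul_le_mul_of_nonneg_left (add_le_add (YY_succ b d) (YY_succ b c)) hK)
  -- angular derivative
  have e1 : YY ℓ (b + 1) (th v1 + v2) + YY ℓ (b + 1) (th v2 - v1) ≤ k1 * S := by
    have t : TangentP (th v1 + v2) (th v2 - v1) := by
      intro p hp
      have := tang_deriv s1 s2 ht p hp
      simp only [th, Pi.add_apply, Pi.sub_apply, Pi.mul_apply, y1, y2]
      linarith
    have := IH _ _ (s1.th.add' s2) (s2.th.sub' s1) t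
    have ed : p1 (th v1 + v2) + p2 (th v2 - v1) = th d := by
      rw [p1_add s1.th s2, p2_sub s2.th s1, p1_th s1, p2_th s2, hd]
      simp only [th]; rw [p1_add s1.p1 s2.p2, p2_add s1.p1 s2.p2]
      ext p; simp; ring
    have ec : p1 (th v2 - v1) - p2 (th v1 + v2) = th c := by
      rw [p1_sub s2.th s1, p2_add s1.th s2, p1_th s2, p2_th s1, hc]
      simp only [th]; rw [p1_sub s2.p1 s1.p2, p2_sub s2.p1 s1.p2]
      ext p; simp; ring
    rw [ed, ec] at this
    have a1 := YY_th (ℓ := ℓ) b sd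
    have a2 := YY_th (ℓ := ℓ) b sc
    refine this.trans ?_
    rw [hk1, mul_assoc]
    refine mul_le_mul_of_nonneg_left ?_ hK
    rw [hS]; linarith
  -- interior bound, generic
  have gen : ∀ f g D C : P3 → ℝ, Sm f → Sm g → Sm D → Sm C →
      p1 f + p2 g = D → p1 g - p2 f = C →
      YY ℓ b f + YY ℓ b g ≤ k0 * S → YY ℓ b D + YY ℓ b C ≤ S →
      YY ℓ (b + 1) (ph f) + YY ℓ (b + 1) (ph g) ≤ k2 * S := by
    intro f g D C sf sg sD sC eD eC hfg hDC
    have := IH _ _ sf.ph sg.ph (ph_tang f g)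
    have q1 : p1 (ph f) + p2 (ph g) = ph D - (2 : ℝ) • (y1 * f) - (2 : ℝ) • (y2 * g) := by
      rw [p1_ph sf, p2_ph sg, ← eD]; ext p; simp [ph]; ring
    have q2 : p1 (ph g) - p2 (ph f) = ph C - (2 : ℝ) • (y1 * g) - (-2 : ℝ) • (y2 * f) := by
      rw [p1_ph sg, p2_ph sf, ← eC]; ext p; simp [ph]; ring
    rw [q1, q2] at this
    have yf1 := sm_y1.mul' sf; have yf2 := sm_y2.mul' sf
    have yg1 := sm_y1.mul' sg; have yg2 := sm_y2.mul' sg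
    have z1 := YY_sub (ℓ := ℓ) b (sD.ph.sub' (yf1.smul' 2)) (yg2.smul' 2)
    have z2 := YY_sub (ℓ := ℓ) b sD.ph (yf1.smul' 2)
    have z3 := YY_sub (ℓ := ℓ) b (sC.ph.sub' (yg1.smul' 2)) (yf2.smul' (-2))
    have z4 := YY_sub (ℓ := ℓ) b sC.ph (yg1.smul' 2)
    rw [YY_smul b yg2] at z1
    rw [YY_smul b yf1] at z2
    rw [YY_smul b yf2] at z3
    rw [YY_smul b yg1] at z4
    simp only [abs_neg, abs_two] at z1 z2 z3 z4
    have w1 := YY_y1 (ℓ := ℓ) b sf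
    have w2 := YY_y2 (ℓ := ℓ) b sf
    have w3 := YY_y1 (ℓ := ℓ) b sg
    have w4 := YY_y2 (ℓ := ℓ) b sg
    have w5 := YY_ph (ℓ := ℓ) b sD
    have w6 := YY_ph (ℓ := ℓ) b sC
    refine this.trans ?_
    rw [hk2, mul_assoc]
    refine mul_le_mul_of_nonneg_left ?_ hK
    have x1 := mul_le_mul_of_nonneg_left hfg (show 0 ≤ 4 * m by positivity)
    have x2 := mul_le_mul_of_nonneg_left hDC (show 0 ≤ 1 + 2 * m ^ 2 by positivity)
    simp only [← hm] at w1 w2 w3 w4 w5 w6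
    linarith
  have e2 : YY ℓ (b + 1) (ph (p1 v1)) + YY ℓ (b + 1) (ph (p1 v2)) ≤ k2 * S := by
    refine gen _ _ (p1 d) (p1 c) s1.p1 s2.p1 sd.p1 sc.p1 ?_ ?_ ?_ ?_
    · rw [hd, p1_add s1.p1 s2.p2, p1_p2 s2]
    · rw [hc, p1_sub s2.p1 s1.p2, p1_p2 s1]
    · exact (add_le_add (YY_p1 b v1) (YY_p1 b v2)).trans e0
    · exact add_le_add (YY_p1 b d) (YY_p1 b c)
  have e3 : YY ℓ (b + 1) (ph (p2 v1)) + YY ℓ (b + 1) (ph (p2 v2)) ≤ k2 * S := by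
    refine gen _ _ (p2 d) (p2 c) s1.p2 s2.p2 sd.p2 sc.p2 ?_ ?_ ?_ ?_
    · rw [hd, p2_add s1.p1 s2.p2, p1_p2 s1]
    · rw [hc, p2_sub s2.p1 s1.p2, p1_p2 s2]
    · exact (add_le_add (YY_p2 b v1) (YY_p2 b v2)).trans e0
    · exact add_le_add (YY_p2 b d) (YY_p2 b c)
  -- bounds on th v
  have n1 := YY_nonneg ℓ (b + 1) v1
  have n2 := YY_nonneg ℓ (b + 1) v2
  have n3 := YY_nonneg ℓ (b + 1) (th v1 + v2)
  have n4 := YY_nonneg ℓ (b + 1) (th v2 - v1)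
  have t1 : YY ℓ (b + 1) (th v1) ≤ (k1 + k0) * S := by
    have := YY_sub (ℓ := ℓ) (b + 1) (s1.th.add' s2) s2
    rw [add_sub_cancel_right] at this; linarith
  have t2 : YY ℓ (b + 1) (th v2) ≤ (k1 + k0) * S := by
    have := YY_add (ℓ := ℓ) (b + 1) (s2.th.sub' s1) s1
    rw [sub_add_cancel] at this; linarith
  have ym1 : ∀ {f : P3 → ℝ}, Sm f → YY ℓ (b + 1) (y1 * f) ≤ m' * YY ℓ (b + 1) f := by
    intro f hf; have := YY_y1 (ℓ := ℓ) (b + 1) hf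
    push_cast at this; rw [hm']; convert this using 2; ring
  have ym2 : ∀ {f : P3 → ℝ}, Sm f → YY ℓ (b + 1) (y2 * f) ≤ m' * YY ℓ (b + 1) f := by
    intro f hf; have := YY_y2 (ℓ := ℓ) (b + 1) hf
    push_cast at this; rw [hm']; convert this using 2; ring
  have radial : ∀ v D C T : P3 → ℝ, Sm v → Sm D → Sm C → Sm T →
      y1 * p1 v + y2 * p2 v = y1 * D + y2 * C + T →
      YY ℓ (b + 1) D + YY ℓ (b + 1) C ≤ 2 * S → YY ℓ (b + 1) T ≤ (k1 + k0) * S →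
      YY ℓ (b + 1) (th v) ≤ (k1 + k0) * S →
      YY ℓ (b + 1) (y1 * (y1 * p1 v) + y2 * (y2 * p1 v)) ≤ k3 * S ∧
      YY ℓ (b + 1) (y1 * (y1 * p2 v) + y2 * (y2 * p2 v)) ≤ k3 * S := by
    intro v D C T sv sD sC sT e hDC hT hth
    set N := y1 * D + y2 * C + T with hN
    have sN : Sm N := ((sm_y1.mul' sD).add' (sm_y2.mul' sC)).add' sT
    have a1 := YY_add (ℓ := ℓ) (b + 1) ((sm_y1.mul' sD).add' (sm_y2.mul' sC)) sT
    have a2 := YY_add (ℓ := ℓ) (b + 1) (sm_y1.mul' sD) (sm_y2.mul' sC)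
    have a3 := ym1 sD; have a4 := ym2 sC
    have a5 := mul_le_mul_of_nonneg_left hDC hm0'
    have bN : YY ℓ (b + 1) N ≤ (2 * m' + k1 + k0) * S := by rw [hN]; linarith
    have bN' := mul_le_mul_of_nonneg_left bN hm0'
    have bt' := mul_le_mul_of_nonneg_left hth hm0'
    constructor
    · have q : y1 * (y1 * p1 v) + y2 * (y2 * p1 v) = y1 * N - y2 * th v := by
        rw [← e]; ext p; simp [th]; ring
      rw [q]
      have := YY_sub (ℓ := ℓ) (b + 1) (sm_y1.mul' sN) (sm_y2.mul' sv.th)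
      have := ym1 sN; have := ym2 sv.th
      rw [hk3]; linarith
    · have q : y1 * (y1 * p2 v) + y2 * (y2 * p2 v) = y2 * N + y1 * th v := by
        rw [← e]; ext p; simp [th]; ring
      rw [q]
      have := YY_add (ℓ := ℓ) (b + 1) (sm_y2.mul' sN) (sm_y1.mul' sv.th)
      have := ym2 sN; have := ym1 sv.th
      rw [hk3]; linarith
  have yneg : ∀ {f : P3 → ℝ}, Sm f → YY ℓ (b + 1) ((-1 : ℝ) • f) = YY ℓ (b + 1) f := by
    intro f hf; rw [YY_smul _ hf]; simp
  have r1 := radial v1 d ((-1 : ℝ) • c) ((-1 : ℝ) • th v2) s1 sd (sc.smul' _) (s2.th.smul' _)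
    (by ext p; simp [hd, hc, th]; ring) (by rw [yneg sc]; linarith) (by rw [yneg s2.th]; exact t2) t1
  have r2 := radial v2 c d (th v1) s2 sc sd s1.th
    (by ext p; simp [hd, hc, th]; ring) (by linarith) t1 t2
  -- assembling
  have asm : ∀ f : P3 → ℝ, Sm f → YY ℓ (b + 1) (y1 * (y1 * f) + y2 * (y2 * f)) ≤ k3 * S →
      YY ℓ (b + 1) f ≤ YY ℓ (b + 1) (ph f) + k3 * S := by
    intro f sf hf
    have := YY_add (ℓ := ℓ) (b + 1) sf.ph
      ((sm_y1.mul' (sm_y1.mul' sf)).add' (sm_y2.mul' (sm_y2.mul' sf)))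
    rw [← add_assoc, ← sum_ph] at this
    linarith
  have f1 := asm _ s1.p1 r1.1
  have f2 := asm _ s1.p2 r1.2
  have f3 := asm _ s2.p1 r2.1
  have f4 := asm _ s2.p2 r2.2
  have g1 := nn_le_YY (ℓ := ℓ) (b + 1) v1
  have g2 := nn_le_YY (ℓ := ℓ) (b + 1) v2
  have u1 : YY ℓ (b + 2) v1 = nn ℓ v1 + YY ℓ (b + 1) (p1 v1) + YY ℓ (b + 1) (p2 v1) := rfl
  have u2 : YY ℓ (b + 2) v2 = nn ℓ v2 + YY ℓ (b + 1) (p1 v2) + YY ℓ (b + 1) (p2 v2) := rfl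
  rw [u1, u2]
  linarith

lemma ell (ℓ : ℝ) (b : ℕ) : ∃ K : ℝ, 0 ≤ K ∧ ∀ v1 v2 : P3 → ℝ, Sm v1 → Sm v2 → TangentP v1 v2 →
      YY ℓ (b + 1) v1 + YY ℓ (b + 1) v2 ≤ K * (YY ℓ b (p1 v1 + p2 v2) + YY ℓ b (p1 v2 - p2 v1)) := by
  induction b with
  | zero => exact ⟨12, by norm_num, fun v1 v2 h1 h2 ht => base_est h1 h2 ht⟩
  | succ b ih => obtain ⟨K, hK, h⟩ := ih; exact ell_step b hK h

/-! ## The full system and its energy identity -/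

structure Sys (ℓ ε : ℝ) (Wa W1 W2 Fa F1 F2 ρ : P3 → ℝ) : Prop where
  sa : Sm Wa
  s1 : Sm W1
  s2 : Sm W2
  ta : Sm Fa
  t1 : Sm F1
  t2 : Sm F2
  tr : Sm ρ
  pa : PerA ℓ Wa
  q1 : PerA ℓ W1
  q2 : PerA ℓ W2
  tg : TangentP W1 W2
  ea : p1 W2 - p2 W1 = Fa
  e1 : p2 Wa = (ε ^ 2) • (F1 + pA W2)
  e2 : p1 Wa = (ε ^ 2) • (pA W1 - F2)
  er : pA Wa + (p1 W1 + p2 W2) = ρ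

lemma tang_pA {W1 W2 : P3 → ℝ} (h1 : Sm W1) (h2 : Sm W2) (ht : TangentP W1 W2) :
    TangentP (pA W1) (pA W2) := by
  intro p hp
  obtain ⟨α, y⟩ := p
  simp only at hp ⊢
  have a := ((hasDerivAt_alpha h1 α y).const_mul y.1).add ((hasDerivAt_alpha h2 α y).const_mul y.2)
  have b : HasDerivAt (fun _ : ℝ => (0 : ℝ)) 0 α := hasDerivAt_const _ _
  have e : (fun α => y.1 * W1 (α, y)) + (fun α => y.2 * W2 (α, y)) = fun _ : ℝ => (0 : ℝ) := by
    ext s; exact ht (s, y) hp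
  have e' : ((fun α => y.1 * W1 (α, y)) + fun α => y.2 * W2 (α, y)) = fun _ : ℝ => (0 : ℝ) := e
  rw [e'] at a
  exact a.unique b

lemma Sys.step {ℓ ε : ℝ} {Wa W1 W2 Fa F1 F2 ρ : P3 → ℝ} (h : Sys ℓ ε Wa W1 W2 Fa F1 F2 ρ) :
    Sys ℓ ε (pA Wa) (pA W1) (pA W2) (pA Fa) (pA F1) (pA F2) (pA ρ) where
  sa := h.sa.pA
  s1 := h.s1.pA
  s2 := h.s2.pA
  ta := h.ta.pA
  t1 := h.t1.pA
  t2 := h.t2.pA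
  tr := h.tr.pA
  pa := h.pa.dv _
  q1 := h.q1.dv _
  q2 := h.q2.dv _
  tg := tang_pA h.s1 h.s2 h.tg
  ea := by rw [← h.ea, pA_sub h.s2.p1 h.s1.p2, pA_p1 h.s2, pA_p2 h.s1]
  e1 := by
    rw [← pA_p2 h.sa, h.e1, pA_eq, dv_smul _ (h.t1.add' (h.s2.dv _)), dv_add _ h.t1 (h.s2.dv _)]
  e2 := by
    rw [← pA_p1 h.sa, h.e2, pA_eq, dv_smul _ ((h.s1.dv _).sub' h.t2), dv_sub _ (h.s1.dv _) h.t2]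
  er := by
    rw [← h.er, pA_add h.sa.pA (h.s1.p1.add' h.s2.p2), pA_add h.s1.p1 h.s2.p2, pA_p1 h.s1, pA_p2 h.s2]

lemma Sys.iter {ℓ ε : ℝ} {Wa W1 W2 Fa F1 F2 ρ : P3 → ℝ} (h : Sys ℓ ε Wa W1 W2 Fa F1 F2 ρ) (a : ℕ) :
    Sys ℓ ε (pA^[a] Wa) (pA^[a] W1) (pA^[a] W2) (pA^[a] Fa) (pA^[a] F1) (pA^[a] F2) (pA^[a] ρ) := by
  induction a generalizing Wa W1 W2 Fa F1 F2 ρ with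
  | zero => exact h
  | succ a ih => exact ih h.step

lemma cross_zero {ℓ : ℝ} (hℓ : 0 < ℓ) {Wa W1 W2 : P3 → ℝ} (sa : Sm Wa) (s1 : Sm W1) (s2 : Sm W2)
    (pa : PerA ℓ Wa) (q1 : PerA ℓ W1) (q2 : PerA ℓ W2) (tg : TangentP W1 W2) :
    II ℓ (pA Wa * p1 W1 - p1 Wa * pA W1 + (pA Wa * p2 W2 - p2 Wa * pA W2)) = 0 := by
  have u1 := sa.pA.mul' s1
  have u2 := sa.pA.mul' s2
  have v1 := sa.p1.mul' s1
  have v2 := sa.p2.mul' s2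
  have e : pA Wa * p1 W1 - p1 Wa * pA W1 + (pA Wa * p2 W2 - p2 Wa * pA W2) =
      p1 (pA Wa * W1) + p2 (pA Wa * W2) - (pA (p1 Wa * W1) + pA (p2 Wa * W2)) := by
    rw [p1_mul sa.pA s1, p2_mul sa.pA s2, pA_mul sa.p1 s1, pA_mul sa.p2 s2, pA_p1 sa, pA_p2 sa]
    ext p; simp; ring
  rw [e, II_sub (u1.p1.add' u2.p2).cont (v1.pA.add' v2.pA).cont, II_add u1.p1.cont u2.p2.cont,
    II_add v1.pA.cont v2.pA.cont, II_pA hℓ v1 ((pa.dv _).mul' q1), II_pA hℓ v2 ((pa.dv _).mul' q2),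
    II_p1 u1, II_p2 u2, ← BB_add (sm_y1.mul' u1).cont (sm_y2.mul' u2).cont]
  rw [BB_congr (g := 0), BB_zero]; · ring
  intro p hp
  have := tg p hp
  simp only [Pi.add_apply, Pi.mul_apply, y1, y2, Pi.zero_apply]
  linear_combination pA Wa p * this

lemma energy3 {ℓ ε : ℝ} (hℓ : 0 < ℓ) {Wa W1 W2 Fa F1 F2 ρ : P3 → ℝ}
    (h : Sys ℓ ε Wa W1 W2 Fa F1 F2 ρ) :
    nn ℓ (pA Wa) ^ 2 + ε ^ 2 * nn ℓ (pA W1) ^ 2 + ε ^ 2 * nn ℓ (pA W2) ^ 2 ≤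
      nn ℓ Fa ^ 2 + ε ^ 2 * nn ℓ F1 ^ 2 + ε ^ 2 * nn ℓ F2 ^ 2 + nn ℓ ρ ^ 2 := by
  have hz := cross_zero hℓ h.sa h.s1 h.s2 h.pa h.q1 h.q2 h.tg
  set Z := pA Wa * p1 W1 - p1 Wa * pA W1 + (pA Wa * p2 W2 - p2 Wa * pA W2) with hZ
  have c1 := h.sa.pA.cont; have c2 := h.s1.pA.cont; have c3 := h.s2.pA.cont
  have c4 := h.ta.cont; have c5 := h.t1.cont; have c6 := h.t2.cont; have c7 := h.tr.cont
  have d1 := h.s1.p1.cont; have d2 := h.s1.p2.cont; have d3 := h.s2.p1.cont; have d4 := h.s2.p2.cont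
  have d5 := h.sa.p1.cont; have d6 := h.sa.p2.cont
  have cZ : Continuous Z := by rw [hZ]; fun_prop
  have key : II ℓ (pA Wa * pA Wa + (ε ^ 2) • (pA W1 * pA W1) + (ε ^ 2) • (pA W2 * pA W2)
      + (2 : ℝ) • Z) ≤
      II ℓ (Fa * Fa + (ε ^ 2) • (F1 * F1) + (ε ^ 2) • (F2 * F2) + ρ * ρ) := by
    refine II_mono (by fun_prop) (by fun_prop) fun p _ => ?_
    have a1 : p2 Wa p = ε ^ 2 * (F1 p + pA W2 p) := congrFun h.e1 p
    have a2 : p1 Wa p = ε ^ 2 * (pA W1 p - F2 p) := congrFun h.e2 p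
    have a3 : pA Wa p + (p1 W1 p + p2 W2 p) = ρ p := congrFun h.er p
    simp only [hZ, Pi.add_apply, Pi.mul_apply, Pi.smul_apply, Pi.sub_apply, smul_eq_mul, a1, a2, ← a3]
    nlinarith [mul_self_nonneg (Fa p), mul_self_nonneg (p1 W1 p + p2 W2 p),
      mul_self_nonneg (ε * (F1 p + pA W2 p)), mul_self_nonneg (ε * (pA W1 p - F2 p))]
  rw [II_add (by fun_prop) (by fun_prop), II_add (by fun_prop) (by fun_prop),
    II_add (by fun_prop) (by fun_prop), II_add (by fun_prop) (by fun_prop),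
    II_add (by fun_prop) (by fun_prop), II_add (by fun_prop) (by fun_prop)] at key
  simp only [II_smul, hz] at key
  simp only [nn_sq]; linarith

lemma energy_bd {ℓ ε : ℝ} (hℓ : 0 < ℓ) (hε : 0 < ε) {Wa W1 W2 Fa F1 F2 ρ : P3 → ℝ}
    (h : Sys ℓ ε Wa W1 W2 Fa F1 F2 ρ) {R : ℝ}
    (hR : nn ℓ Fa + ε * nn ℓ F1 + ε * nn ℓ F2 + nn ℓ ρ ≤ R) :
    nn ℓ (pA Wa) ≤ R ∧ ε * nn ℓ (pA W1) ≤ R ∧ ε * nn ℓ (pA W2) ≤ R := by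
  have e := energy3 hℓ h
  have a1 := nn_nonneg ℓ Fa
  have a2 := mul_nonneg hε.le (nn_nonneg ℓ F1)
  have a3 := mul_nonneg hε.le (nn_nonneg ℓ F2)
  have a4 := nn_nonneg ℓ ρ
  have b1 := sq_nonneg (nn ℓ (pA Wa))
  have b2 := sq_nonneg (ε * nn ℓ (pA W1))
  have b3 := sq_nonneg (ε * nn ℓ (pA W2))
  rw [mul_pow] at b2 b3
  have hR0 : 0 ≤ R := by linarith
  have e2 : nn ℓ Fa ^ 2 + ε ^ 2 * nn ℓ F1 ^ 2 + ε ^ 2 * nn ℓ F2 ^ 2 + nn ℓ ρ ^ 2 ≤ R ^ 2 := by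
    refine le_trans ?_ (pow_le_pow_left₀ (by linarith) hR 2)
    have := mul_nonneg a1 a2; have := mul_nonneg a1 a3; have := mul_nonneg a1 a4
    have := mul_nonneg a2 a3; have := mul_nonneg a2 a4; have := mul_nonneg a3 a4
    nlinarith
  refine ⟨le_of_sq_le_sq'' ?_ hR0, le_of_sq_le_sq'' ?_ hR0, le_of_sq_le_sq'' ?_ hR0⟩
  · linarith
  · rw [mul_pow]; linarith
  · rw [mul_pow]; linarith

/-! ## Poincaré inequality on the disk, via polar coordinates -/

lemma cs1 {a b : ℝ} (hab : a ≤ b) {g : ℝ → ℝ} (hg : Continuous g) :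
    (∫ x in a..b, g x) ^ 2 ≤ (b - a) * ∫ x in a..b, g x ^ 2 := by
  rcases hab.eq_or_lt with rfl | h
  · simp
  set I := ∫ x in a..b, g x with hI
  have h0 : 0 ≤ ∫ x in a..b, ((b - a) * g x - I) ^ 2 :=
    intervalIntegral.integral_nonneg hab fun x _ => sq_nonneg _
  have e : ∫ x in a..b, ((b - a) * g x - I) ^ 2 =
      (b - a) ^ 2 * (∫ x in a..b, g x ^ 2) - 2 * (b - a) * I * I + (b - a) * I ^ 2 := by
    have : ∀ x, ((b - a) * g x - I) ^ 2 = (b - a) ^ 2 * g x ^ 2 - 2 * (b - a) * I * g x + I ^ 2 := by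
      intro x; ring
    simp only [this]
    rw [intervalIntegral.integral_add (Continuous.intervalIntegrable (by fun_prop) _ _)
        (Continuous.intervalIntegrable (by fun_prop) _ _),
      intervalIntegral.integral_sub (Continuous.intervalIntegrable (by fun_prop) _ _)
        (Continuous.intervalIntegrable (by fun_prop) _ _),
      intervalIntegral.integral_const_mul, intervalIntegral.integral_const_mul,
      intervalIntegral.integral_const, smul_eq_mul]
  rw [e] at h0
  have hp : 0 < b - a := sub_pos.2 h
  have : 0 ≤ (b - a) * ((b - a) * (∫ x in a..b, g x ^ 2) - I ^ 2) := by nlinarith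
  have := nonneg_of_mul_nonneg_right this hp
  linarith

lemma pairvar {a b B : ℝ} (hab : a ≤ b) {w f : ℝ → ℝ} (hw : Continuous w) (hf : Continuous f)
    (h : ∀ x ∈ Set.Icc a b, ∀ y ∈ Set.Icc a b, w x * w y * (f x - f y) ^ 2 ≤ B) :
    2 * ((∫ x in a..b, w x) * (∫ x in a..b, w x * f x ^ 2) - (∫ x in a..b, w x * f x) ^ 2) ≤
      B * (b - a) ^ 2 := by
  set A0 := ∫ x in a..b, w x with hA0
  set A1 := ∫ x in a..b, w x * f x with hA1
  set A2 := ∫ x in a..b, w x * f x ^ 2 with hA2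
  have st : ∀ y ∈ Set.Icc a b, w y * A2 - 2 * A1 * (w y * f y) + A0 * (w y * f y ^ 2) ≤ B * (b - a) := by
    intro y hy
    have h1 : ∫ x in a..b, w x * w y * (f x - f y) ^ 2 ≤ ∫ x in a..b, B :=
      intervalIntegral.integral_mono_on hab (Continuous.intervalIntegrable (by fun_prop) _ _)
        (Continuous.intervalIntegrable (by fun_prop) _ _) fun x hx => h x hx y hy
    have e : ∀ x, w x * w y * (f x - f y) ^ 2 =
        w y * (w x * f x ^ 2) - (2 * w y * f y) * (w x * f x) + (w y * f y ^ 2) * w x := by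
      intro x; ring
    simp only [e] at h1
    rw [intervalIntegral.integral_add (Continuous.intervalIntegrable (by fun_prop) _ _)
        (Continuous.intervalIntegrable (by fun_prop) _ _),
      intervalIntegral.integral_sub (Continuous.intervalIntegrable (by fun_prop) _ _)
        (Continuous.intervalIntegrable (by fun_prop) _ _),
      intervalIntegral.integral_const_mul, intervalIntegral.integral_const_mul,
      intervalIntegral.integral_const_mul,
      intervalIntegral.integral_const, smul_eq_mul] at h1
    linarith
  have h2 : ∫ y in a..b, (w y * A2 - 2 * A1 * (w y * f y) + A0 * (w y * f y ^ 2)) ≤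
      ∫ y in a..b, B * (b - a) :=
    intervalIntegral.integral_mono_on hab (Continuous.intervalIntegrable (by fun_prop) _ _)
        (Continuous.intervalIntegrable (by fun_prop) _ _) st
  rw [intervalIntegral.integral_add (Continuous.intervalIntegrable (by fun_prop) _ _)
        (Continuous.intervalIntegrable (by fun_prop) _ _),
      intervalIntegral.integral_sub (Continuous.intervalIntegrable (by fun_prop) _ _)
        (Continuous.intervalIntegrable (by fun_prop) _ _),
      intervalIntegral.integral_const_mul, intervalIntegral.integral_const_mul,
      intervalIntegral.integral_mul_const,
      intervalIntegral.integral_const, smul_eq_mul] at h2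
  nlinarith

lemma pol_cont {A : ℝ → ℝ → ℝ} (hA : Continuous (Function.uncurry A)) (a b : ℝ) :
    Continuous fun r => ∫ θ in a..b, A r θ :=
  intervalIntegral.continuous_parametric_intervalIntegral_of_continuous' hA a b

lemma polar_poincare {u ur ut G : ℝ → ℝ → ℝ} (cu : Continuous (Function.uncurry u))
    (cr : Continuous (Function.uncurry ur)) (ct : Continuous (Function.uncurry ut))
    (cG : Continuous (Function.uncurry G))
    (dr : ∀ r θ, HasDerivAt (fun r => u r θ) (ur r θ) r)
    (dt : ∀ r θ, HasDerivAt (fun θ => u r θ) (ut r θ) θ)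
    (br : ∀ r θ, ur r θ ^ 2 ≤ G r θ) (bt : ∀ r θ, ut r θ ^ 2 ≤ r ^ 2 * G r θ) :
    π * (∫ r in (0:ℝ)..1, r * ∫ θ in (-π)..π, u r θ ^ 2) ≤
      (∫ r in (0:ℝ)..1, r * ∫ θ in (-π)..π, u r θ) ^ 2 +
        (π + 2 * π ^ 3) * ∫ r in (0:ℝ)..1, r * ∫ θ in (-π)..π, G r θ := by
  have hpi : -π ≤ π := by linarith [pi_pos]
  have hpp := pi_pos
  have cuθ : ∀ r, Continuous (u r) := fun r => cu.uncurry_left r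
  have crθ : ∀ r, Continuous (ur r) := fun r => cr.uncurry_left r
  have ctθ : ∀ r, Continuous (ut r) := fun r => ct.uncurry_left r
  have cGθ : ∀ r, Continuous (G r) := fun r => cG.uncurry_left r
  have crr : ∀ θ, Continuous (fun r => ur r θ) := fun θ => cr.uncurry_right θ
  have G0 : ∀ r θ, 0 ≤ G r θ := fun r θ => (sq_nonneg _).trans (br r θ)
  have cu2 : Continuous (Function.uncurry fun r θ => u r θ ^ 2) := cu.pow 2
  set M : ℝ → ℝ := fun r => ∫ θ in (-π)..π, u r θ with hM
  set q : ℝ → ℝ := fun r => ∫ θ in (-π)..π, u r θ ^ 2 with hq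
  set γ : ℝ → ℝ := fun r => ∫ θ in (-π)..π, G r θ with hγ
  set N : ℝ → ℝ := fun r => ∫ θ in (-π)..π, ur r θ with hN
  have cM : Continuous M := pol_cont cu _ _
  have cq : Continuous q := pol_cont cu2 _ _
  have cγ : Continuous γ := pol_cont cG _ _
  have cN : Continuous N := pol_cont cr _ _
  have γ0 : ∀ r, 0 ≤ γ r := fun r => intervalIntegral.integral_nonneg hpi fun θ _ => G0 r θ
  -- angular step
  have step1 : ∀ r ∈ Set.Icc (0:ℝ) 1, 2 * π * q r ≤ M r ^ 2 + 4 * π ^ 3 * γ r := by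
    intro r hr
    have mono : ∀ s t : ℝ, s ∈ Set.Icc (-π) π → t ∈ Set.Icc (-π) π → s ≤ t →
        (u r t - u r s) ^ 2 ≤ 2 * π * γ r := by
      intro s t hs ht hst
      have e := intervalIntegral.integral_eq_sub_of_hasDerivAt (a := s) (b := t) (fun θ _ => dt r θ)
        ((ctθ r).intervalIntegrable _ _)
      rw [← e]
      refine (cs1 hst (ctθ r)).trans ?_
      have h1 : ∫ x in s..t, ut r x ^ 2 ≤ ∫ x in s..t, G r x := by
        refine intervalIntegral.integral_mono_on hst (((ctθ r).pow 2).intervalIntegrable _ _)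
          ((cGθ r).intervalIntegrable _ _) fun x _ => ?_
        refine (bt r x).trans ?_
        have : r ^ 2 ≤ 1 := by nlinarith [hr.1, hr.2]
        nlinarith [G0 r x]
      have h2 : ∫ x in s..t, G r x ≤ γ r :=
        intervalIntegral.integral_mono_interval hs.1 hst ht.2
          (Filter.Eventually.of_forall fun x => G0 r x) ((cGθ r).intervalIntegrable _ _)
      have h3 : 0 ≤ ∫ x in s..t, ut r x ^ 2 :=
        intervalIntegral.integral_nonneg hst fun x _ => sq_nonneg _
      have h4 : t - s ≤ 2 * π := by linarith [hs.1, ht.2]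
      exact mul_le_mul h4 (h1.trans h2) h3 (by positivity)
    have pv := pairvar (B := 2 * π * γ r) (w := fun _ => 1) hpi continuous_const (cuθ r) (by
      intro x hx y hy
      rcases le_total x y with h | h
      · have := mono x y hx hy h; linarith [sub_sq_comm (u r x) (u r y)]
      · have := mono y x hy hx h; linarith)
    simp only [one_mul, intervalIntegral.integral_const, smul_eq_mul, mul_one] at pv
    change 2 * ((π - -π) * q r - M r ^ 2) ≤ _ at pv
    nlinarith
  -- radial step
  set E := ∫ r in (0:ℝ)..1, r * γ r with hE
  have step2 : (∫ r in (0:ℝ)..1, r * M r ^ 2) ≤ 2 * (∫ r in (0:ℝ)..1, r * M r) ^ 2 + 2 * π * E := by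
    have NN : ∀ t, N t ^ 2 ≤ 2 * π * γ t := by
      intro t
      refine (cs1 hpi (crθ t)).trans ?_
      have : ∫ x in (-π)..π, ur t x ^ 2 ≤ γ t :=
        intervalIntegral.integral_mono_on hpi (((crθ t).pow 2).intervalIntegrable _ _)
          ((cGθ t).intervalIntegrable _ _) fun x _ => br t x
      nlinarith
    have mono : ∀ r s : ℝ, r ∈ Set.Icc (0:ℝ) 1 → s ∈ Set.Icc (0:ℝ) 1 → r ≤ s →
        r * s * (M s - M r) ^ 2 ≤ 2 * π * E := by
      intro r s hr hs hrs
      have e : M s - M r = ∫ t in r..s, N t := by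
        rw [hN, swap_cont cr hrs hpi]
        have : ∀ θ, ∫ t in r..s, ur t θ = u s θ - u r θ := fun θ =>
          intervalIntegral.integral_eq_sub_of_hasDerivAt (fun t _ => dr t θ)
            ((crr θ).intervalIntegrable _ _)
        simp only [this]
        rw [intervalIntegral.integral_sub ((cuθ s).intervalIntegrable _ _) ((cuθ r).intervalIntegrable _ _)]
      rw [e]
      have h1 := cs1 hrs cN
      have h0 : 0 ≤ ∫ t in r..s, N t ^ 2 := intervalIntegral.integral_nonneg hrs fun x _ => sq_nonneg _
      have h2 : r * ∫ t in r..s, N t ^ 2 ≤ ∫ t in r..s, 2 * π * (t * γ t) := by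
        rw [← intervalIntegral.integral_const_mul]
        refine intervalIntegral.integral_mono_on hrs (Continuous.intervalIntegrable (by fun_prop) _ _)
          (Continuous.intervalIntegrable (by fun_prop) _ _) fun x hx => ?_
        have := NN x
        have x0 : 0 ≤ x := hr.1.trans hx.1
        calc r * N x ^ 2 ≤ x * N x ^ 2 := mul_le_mul_of_nonneg_right hx.1 (sq_nonneg _)
          _ ≤ x * (2 * π * γ x) := mul_le_mul_of_nonneg_left this x0
          _ = _ := by ring
      have h3 : ∫ t in r..s, 2 * π * (t * γ t) ≤ ∫ t in (0:ℝ)..1, 2 * π * (t * γ t) := by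
        refine intervalIntegral.integral_mono_interval hr.1 hrs hs.2 ?_
          (Continuous.intervalIntegrable (by fun_prop) _ _)
        refine (ae_restrict_iff' measurableSet_Ioc).2 (Filter.Eventually.of_forall fun x hx => ?_)
        have := γ0 x; have := hx.1.le; simp only [Pi.zero_apply]; positivity
      have h4 : ∫ t in (0:ℝ)..1, 2 * π * (t * γ t) = 2 * π * E := intervalIntegral.integral_const_mul _ _
      have hs1 : s * (s - r) ≤ 1 := by nlinarith [hr.1, hr.2, hs.1, hs.2]
      have hs0 : 0 ≤ s * (s - r) := mul_nonneg hs.1 (sub_nonneg.2 hrs)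
      have h5 : 0 ≤ r * ∫ t in r..s, N t ^ 2 := mul_nonneg hr.1 h0
      calc r * s * (∫ t in r..s, N t) ^ 2 ≤ r * s * ((s - r) * ∫ t in r..s, N t ^ 2) :=
            mul_le_mul_of_nonneg_left h1 (mul_nonneg hr.1 hs.1)
        _ = (s * (s - r)) * (r * ∫ t in r..s, N t ^ 2) := by ring
        _ ≤ 1 * (r * ∫ t in r..s, N t ^ 2) := mul_le_mul_of_nonneg_right hs1 h5
        _ ≤ _ := by linarith
    have pv := pairvar (B := 2 * π * E) (w := fun r => r) zero_le_one continuous_id cM (by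
      intro x hx y hy
      rcases le_total x y with h | h
      · have := mono x y hx hy h; rw [sub_sq_comm]; linarith
      · have := mono y x hy hx h; rw [mul_comm x y]; linarith)
    simp only [integral_id] at pv
    linarith
  have step3 : 2 * π * (∫ r in (0:ℝ)..1, r * q r) ≤ (∫ r in (0:ℝ)..1, r * M r ^ 2) + 4 * π ^ 3 * E := by
    rw [hE, ← intervalIntegral.integral_const_mul, ← intervalIntegral.integral_const_mul,
      ← intervalIntegral.integral_add (Continuous.intervalIntegrable (by fun_prop) _ _)
        (Continuous.intervalIntegrable (by fun_prop) _ _)]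
    refine intervalIntegral.integral_mono_on zero_le_one (Continuous.intervalIntegrable (by fun_prop) _ _)
        (Continuous.intervalIntegrable (by fun_prop) _ _) fun r hr => ?_
    have := mul_le_mul_of_nonneg_left (step1 r hr) hr.1
    linarith
  linarith

lemma disk_poincare {g : ℝ × ℝ → ℝ} (hg : ContDiff ℝ 1 g) :
    π * (∫ y in disk, g y ^ 2) ≤ (∫ y in disk, g y) ^ 2 +
      (π + 2 * π ^ 3) * ∫ y in disk, (fderiv ℝ g y (1, 0) ^ 2 + fderiv ℝ g y (0, 1) ^ 2) := by
  have hfd : Continuous (fderiv ℝ g) := hg.continuous_fderiv (by simp)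
  have hgc : Continuous g := hg.continuous
  have hd : Differentiable ℝ g := hg.differentiable (by simp)
  have hfv : ∀ v : ℝ × ℝ, Continuous fun y => fderiv ℝ g y v := fun v => hfd.clm_apply continuous_const
  have f1 := hfv (1, 0); have f2 := hfv (0, 1)
  have hp : Continuous fun q : ℝ × ℝ => (q.1 * cos q.2, q.1 * sin q.2) := by fun_prop
  have e0 := hgc.comp hp
  have e1 := f1.comp hp
  have e2 := f2.comp hp
  simp only [Function.comp_def] at e0 e1 e2
  rw [disk_polar (F := fun y => g y ^ 2) (by fun_prop), disk_polar hgc,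
    disk_polar (F := fun y => fderiv ℝ g y (1, 0) ^ 2 + fderiv ℝ g y (0, 1) ^ 2) (by fun_prop)]
  simp only [intervalIntegral.integral_const_mul]
  refine polar_poincare (u := fun r θ => g (r * cos θ, r * sin θ))
    (ur := fun r θ => cos θ * fderiv ℝ g (r * cos θ, r * sin θ) (1, 0)
      + sin θ * fderiv ℝ g (r * cos θ, r * sin θ) (0, 1))
    (ut := fun r θ => -(r * sin θ) * fderiv ℝ g (r * cos θ, r * sin θ) (1, 0)
      + r * cos θ * fderiv ℝ g (r * cos θ, r * sin θ) (0, 1))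
    (G := fun r θ => fderiv ℝ g (r * cos θ, r * sin θ) (1, 0) ^ 2 + fderiv ℝ g (r * cos θ, r * sin θ) (0, 1) ^ 2)
    ?_ ?_ ?_ ?_ ?_ ?_ ?_ ?_
  · exact e0
  · simp only [Function.uncurry_def]; fun_prop
  · simp only [Function.uncurry_def]; fun_prop
  · simp only [Function.uncurry_def]; fun_prop
  · intro r θ
    have h1 : HasDerivAt (fun r : ℝ => (r * cos θ, r * sin θ)) (cos θ, sin θ) r := by
      simpa using ((hasDerivAt_id r).mul_const (cos θ)).prodMk ((hasDerivAt_id r).mul_const (sin θ))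
    have h2 := (hd (r * cos θ, r * sin θ)).hasFDerivAt.comp_hasDerivAt r h1
    rw [fd_lin] at h2; exact h2
  · intro r θ
    have h1 : HasDerivAt (fun θ : ℝ => (r * cos θ, r * sin θ)) (-(r * sin θ), r * cos θ) θ := by
      simpa using ((hasDerivAt_cos θ).const_mul r).prodMk ((hasDerivAt_sin θ).const_mul r)
    have h2 := (hd (r * cos θ, r * sin θ)).hasFDerivAt.comp_hasDerivAt θ h1
    rw [fd_lin] at h2; exact h2
  · intro r θ
    generalize fderiv ℝ g (r * cos θ, r * sin θ) (1, 0) = u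
    generalize fderiv ℝ g (r * cos θ, r * sin θ) (0, 1) = v
    have hs := sin_sq_add_cos_sq θ
    have : u ^ 2 + v ^ 2 = (cos θ * u + sin θ * v) ^ 2 + (sin θ * u - cos θ * v) ^ 2 := by
      linear_combination (-u ^ 2 - v ^ 2) * hs
    rw [this]; linarith [sq_nonneg (sin θ * u - cos θ * v)]
  · intro r θ
    generalize fderiv ℝ g (r * cos θ, r * sin θ) (1, 0) = u
    generalize fderiv ℝ g (r * cos θ, r * sin θ) (0, 1) = v
    have hs := sin_sq_add_cos_sq θ
    have : r ^ 2 * (u ^ 2 + v ^ 2) = (-(r * sin θ) * u + r * cos θ * v) ^ 2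
        + (r * (cos θ * u + sin θ * v)) ^ 2 := by
      linear_combination (-(r ^ 2 * u ^ 2) - r ^ 2 * v ^ 2) * hs
    rw [this]; linarith [sq_nonneg (r * (cos θ * u + sin θ * v))]

/-! ## Estimate of the slow component -/

/-- fiber mean -/
def mm (h : P3 → ℝ) (α : ℝ) : ℝ := ∫ y in disk, h (α, y)

lemma mm_cont {h : P3 → ℝ} (hh : Continuous h) : Continuous (mm h) := by
  have hc : Continuous (Function.uncurry fun (α : ℝ) (y : ℝ × ℝ) => h (α, y)) := hh
  exact continuous_parametric_integral_of_continuous hc disk_compact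

lemma fiber_poincare {ℓ : ℝ} (hℓ : 0 < ℓ) {h : P3 → ℝ} (hh : Sm h) :
    π * II ℓ (h * h) ≤ (∫ α in Set.Ioc 0 ℓ, mm h α ^ 2) +
      (π + 2 * π ^ 3) * II ℓ (p1 h * p1 h + p2 h * p2 h) := by
  have c0 := hh.cont; have c1 := hh.p1.cont; have c2 := hh.p2.cont
  have key : ∀ α, π * mm (h * h) α ≤ mm h α ^ 2 + (π + 2 * π ^ 3) * mm (p1 h * p1 h + p2 h * p2 h) α := by
    intro α
    have hg : ContDiff ℝ 1 (fun y : ℝ × ℝ => h (α, y)) :=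
      (ContDiff.comp hh (contDiff_const.prodMk contDiff_id)).of_le (by exact WithTop.coe_le_coe.2 le_top)
    have := disk_poincare hg
    simp only [fiber_fderiv hh] at this
    simpa only [mm, Pi.mul_apply, Pi.add_apply, ← sq, Pi.pow_apply, p1, p2] using this
  have i1 : ∀ f : ℝ → ℝ, Continuous f → IntegrableOn f (Set.Ioc 0 ℓ) := fun f hf =>
    (hf.continuousOn.integrableOn_compact isCompact_Icc).mono_set Set.Ioc_subset_Icc_self
  have m1 := mm_cont (show Continuous (h * h) by fun_prop)
  have m2 := mm_cont c0
  have m3 := mm_cont (show Continuous (p1 h * p1 h + p2 h * p2 h) by fun_prop)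
  have : ∫ α in Set.Ioc 0 ℓ, π * mm (h * h) α ≤
      ∫ α in Set.Ioc 0 ℓ, (mm h α ^ 2 + (π + 2 * π ^ 3) * mm (p1 h * p1 h + p2 h * p2 h) α) :=
    setIntegral_mono (i1 _ (by fun_prop)) (i1 _ (by fun_prop)) key
  rw [integral_add (i1 _ (by fun_prop)) (i1 _ (by fun_prop)), integral_const_mul,
    integral_const_mul] at this
  rw [II_fub (show Continuous (h * h) by fun_prop),
    II_fub (show Continuous (p1 h * p1 h + p2 h * p2 h) by fun_prop)]
  exact this

lemma mm_tang {W1 W2 : P3 → ℝ} (s1 : Sm W1) (s2 : Sm W2) (tg : TangentP W1 W2) (α : ℝ) :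
    mm (p1 W1 + p2 W2) α = 0 := by
  have a1 := fiber_div s1 α 1 0
  have a2 := fiber_div s2 α 0 1
  have c1 : Continuous fun y : ℝ × ℝ => p1 W1 (α, y) := s1.p1.cont.comp (by fun_prop)
  have c2 : Continuous fun y : ℝ × ℝ => p2 W2 (α, y) := s2.p2.cont.comp (by fun_prop)
  have i : ∀ f : ℝ × ℝ → ℝ, Continuous f → IntegrableOn f disk := fun f hf =>
    hf.continuousOn.integrableOn_compact disk_compact
  have e : mm (p1 W1 + p2 W2) α = (∫ y in disk, p1 W1 (α, y)) + ∫ y in disk, p2 W2 (α, y) :=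
    integral_add (i _ c1) (i _ c2)
  rw [e]
  change (∫ y in disk, p1 W1 (α, y)) = _ at a1
  change (∫ y in disk, p2 W2 (α, y)) = _ at a2
  have k1 := s1.cont; have k2 := s2.cont
  have j : ∀ f : ℝ → ℝ, Continuous f → IntegrableOn f (Set.Ioc (-π) π) := fun f hf =>
    (hf.continuousOn.integrableOn_compact isCompact_Icc).mono_set Set.Ioc_subset_Icc_self
  rw [a1, a2, ← integral_add (j _ (by fun_prop)) (j _ (by fun_prop))]
  have : ∀ θ : ℝ, (1 * cos θ + 0 * sin θ) * W1 (α, cos θ, sin θ) +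
      (0 * cos θ + 1 * sin θ) * W2 (α, cos θ, sin θ) = 0 := by
    intro θ
    have := tg (α, cos θ, sin θ) (by simp)
    simp only at this
    linarith
  simp only [this, integral_zero]

lemma mm_diff {ℓ : ℝ} {Wa W1 W2 ρ : P3 → ℝ} (sa : Sm Wa) (s1 : Sm W1) (s2 : Sm W2)
    (tr : Sm ρ) (tg : TangentP W1 W2) (er : pA Wa + (p1 W1 + p2 W2) = ρ)
    {a b : ℝ} (ha : 0 ≤ a) (hab : a ≤ b) (hb : b ≤ ℓ) :
    |mm Wa b - mm Wa a| ≤ nn ℓ ρ * nn ℓ 1 := by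
  have i : ∀ f : ℝ × ℝ → ℝ, Continuous f → IntegrableOn f disk := fun f hf =>
    hf.continuousOn.integrableOn_compact disk_compact
  have cr := tr.cont
  have ca : Continuous fun p => |ρ p| := cr.abs
  have cf : ∀ f : P3 → ℝ, Continuous f → ∀ α : ℝ, Continuous fun y : ℝ × ℝ => f (α, y) := fun f hf α =>
    hf.comp (by fun_prop)
  have e1 : mm Wa b - mm Wa a = ∫ α in a..b, mm (pA Wa) α := by
    rw [mm, mm, ← integral_sub (i _ (cf _ sa.cont _)) (i _ (cf _ sa.cont _))]
    simp only [← alpha_ftc sa, intervalIntegral.integral_of_le hab, mm]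
    refine integral_integral_swap (f := fun y α => pA Wa (α, y)) ?_
    rw [Measure.prod_restrict]
    have c : Continuous (Function.uncurry fun (y : ℝ × ℝ) (α : ℝ) => pA Wa (α, y)) := by
      have := sa.pA.cont
      simp only [Function.uncurry_def]; fun_prop
    exact (c.continuousOn.integrableOn_compact (disk_compact.prod isCompact_Icc)).mono_set
      (Set.prod_mono le_rfl Set.Ioc_subset_Icc_self)
  have e2 : ∀ α, mm (pA Wa) α = mm ρ α := by
    intro α
    have h1 := mm_tang s1 s2 tg α
    have h2 : mm ρ α = mm (pA Wa) α + mm (p1 W1 + p2 W2) α := by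
      rw [← er]
      exact integral_add (i _ (cf _ sa.pA.cont _)) (i _ (cf _ (s1.p1.add' s2.p2).cont _))
    rw [h2, h1, add_zero]
  simp only [e2] at e1
  rw [e1]
  have b1 : ∀ α, |mm ρ α| ≤ mm (fun p => |ρ p|) α := fun α => abs_integral_le_integral_abs
  have m1 := mm_cont cr
  have m2 := mm_cont ca
  have m0 : ∀ α, 0 ≤ mm (fun p => |ρ p|) α := fun α => integral_nonneg fun _ => abs_nonneg _
  calc |∫ α in a..b, mm ρ α| ≤ ∫ α in a..b, |mm ρ α| := intervalIntegral.abs_integral_le_integral_abs hab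
    _ ≤ ∫ α in a..b, mm (fun p => |ρ p|) α :=
        intervalIntegral.integral_mono hab (m1.abs.intervalIntegrable _ _) (m2.intervalIntegrable _ _) b1
    _ ≤ ∫ α in (0:ℝ)..ℓ, mm (fun p => |ρ p|) α :=
        intervalIntegral.integral_mono_interval ha hab hb (Filter.Eventually.of_forall m0)
          (m2.intervalIntegrable _ _)
    _ = II ℓ ((fun p => |ρ p|) * 1) := by
        rw [mul_one, II_fub ca, intervalIntegral.integral_of_le (ha.trans (hab.trans hb))]; rfl
    _ ≤ nn ℓ (fun p => |ρ p|) * nn ℓ 1 := II_cs ca continuous_one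
    _ = nn ℓ ρ * nn ℓ 1 := by
        have : (fun p => |ρ p|) * (fun p => |ρ p|) = ρ * ρ := by ext p; simp
        simp only [nn, this]

lemma mm_bd {ℓ : ℝ} (hℓ : 0 < ℓ) {Wa W1 W2 ρ : P3 → ℝ} (sa : Sm Wa) (s1 : Sm W1) (s2 : Sm W2)
    (tr : Sm ρ) (tg : TangentP W1 W2) (er : pA Wa + (p1 W1 + p2 W2) = ρ)
    {α : ℝ} (hα : α ∈ Set.Icc 0 ℓ) :
    |mm Wa α| ≤ nn ℓ ρ * nn ℓ 1 + |II ℓ Wa| / ℓ := by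
  set D := nn ℓ ρ * nn ℓ 1 with hD
  have m := mm_cont sa.cont
  have h1 : ∀ β ∈ Set.Icc 0 ℓ, |mm Wa α - mm Wa β| ≤ D := by
    intro β hβ
    rcases le_total β α with h | h
    · exact mm_diff sa s1 s2 tr tg er hβ.1 h hα.2
    · rw [abs_sub_comm]; exact mm_diff sa s1 s2 tr tg er hα.1 h hβ.2
  have h2 : ∫ β in (0:ℝ)..ℓ, mm Wa β = II ℓ Wa := by
    rw [II_fub sa.cont, intervalIntegral.integral_of_le hℓ.le]; rfl
  have h3 : ∫ β in (0:ℝ)..ℓ, (mm Wa α - mm Wa β) = ℓ * mm Wa α - II ℓ Wa := by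
    rw [intervalIntegral.integral_sub (continuous_const.intervalIntegrable _ _) (m.intervalIntegrable _ _), h2]
    simp
  have h4 : |∫ β in (0:ℝ)..ℓ, (mm Wa α - mm Wa β)| ≤ D * |ℓ - 0| := by
    refine intervalIntegral.norm_integral_le_of_norm_le_const (f := fun β => mm Wa α - mm Wa β) fun β hβ => ?_
    rw [Set.uIoc_of_le hℓ.le] at hβ
    exact h1 β ⟨hβ.1.le, hβ.2⟩
  rw [h3, sub_zero, abs_of_pos hℓ] at h4
  have h5 : ℓ * |mm Wa α| ≤ D * ℓ + |II ℓ Wa| := by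
    have := abs_sub_abs_le_abs_sub (ℓ * mm Wa α) (II ℓ Wa)
    rw [abs_mul, abs_of_pos hℓ] at this
    linarith
  have : |mm Wa α| ≤ (D * ℓ + |II ℓ Wa|) / ℓ := by rw [le_div_iff₀ hℓ]; linarith
  refine this.trans (le_of_eq ?_)
  field_simp

lemma slow_bd (ℓ : ℝ) (hℓ : 0 < ℓ) : ∃ C : ℝ, 0 ≤ C ∧ ∀ Wa W1 W2 ρ : P3 → ℝ, Sm Wa → Sm W1 → Sm W2 →
    Sm ρ → TangentP W1 W2 → pA Wa + (p1 W1 + p2 W2) = ρ →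
    nn ℓ Wa ≤ C * (nn ℓ (p1 Wa) + nn ℓ (p2 Wa) + nn ℓ ρ + |II ℓ Wa|) := by
  have hpp := pi_pos
  set c := nn ℓ 1 + 1 / ℓ with hc
  have n1 := nn_nonneg ℓ 1
  have c0 : 0 ≤ c := by positivity
  set K := (ℓ * c ^ 2 + (π + 2 * π ^ 3)) / π with hK
  have K0 : 0 ≤ K := by positivity
  refine ⟨K + 1, by positivity, fun Wa W1 W2 ρ sa s1 s2 tr tg er => ?_⟩
  set x := nn ℓ (p1 Wa) with hx
  set y := nn ℓ (p2 Wa) with hy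
  set z := nn ℓ ρ with hz
  set Q := |II ℓ Wa| with hQ
  have x0 : 0 ≤ x := nn_nonneg _ _
  have y0 : 0 ≤ y := nn_nonneg _ _
  have z0 : 0 ≤ z := nn_nonneg _ _
  have Q0 : 0 ≤ Q := abs_nonneg _
  have fp := fiber_poincare hℓ sa
  rw [II_add (sa.p1.mul' sa.p1).cont (sa.p2.mul' sa.p2).cont, ← nn_sq, ← nn_sq, ← nn_sq] at fp
  have mb : ∀ α ∈ Set.Ioc 0 ℓ, mm Wa α ^ 2 ≤ (c * (z + Q)) ^ 2 := by
    intro α hα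
    have := mm_bd hℓ sa s1 s2 tr tg er ⟨hα.1.le, hα.2⟩
    rw [← sq_abs]
    refine pow_le_pow_left₀ (abs_nonneg _) (this.trans ?_) 2
    rw [hc]
    have : 0 ≤ nn ℓ 1 * Q := by positivity
    have : 0 ≤ 1 / ℓ * z := by positivity
    have e : |II ℓ Wa| / ℓ = 1 / ℓ * Q := by rw [hQ]; ring
    rw [e]; linarith
  have mI : ∫ α in Set.Ioc 0 ℓ, mm Wa α ^ 2 ≤ ℓ * (c * (z + Q)) ^ 2 := by
    have i1 : ∀ f : ℝ → ℝ, Continuous f → IntegrableOn f (Set.Ioc 0 ℓ) := fun f hf =>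
      (hf.continuousOn.integrableOn_compact isCompact_Icc).mono_set Set.Ioc_subset_Icc_self
    refine (setIntegral_mono_on (i1 _ ((mm_cont sa.cont).pow 2)) (i1 _ continuous_const)
      measurableSet_Ioc mb).trans ?_
    simp [hℓ.le]
  have S0 : 0 ≤ x + y + z + Q := by positivity
  have hsq : nn ℓ Wa ^ 2 ≤ K * (x + y + z + Q) ^ 2 := by
    have a1 : (z + Q) ^ 2 ≤ (x + y + z + Q) ^ 2 := pow_le_pow_left₀ (by positivity) (by linarith) 2
    have a2 : x ^ 2 + y ^ 2 ≤ (x + y + z + Q) ^ 2 := by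
      have : (x + y) ^ 2 ≤ (x + y + z + Q) ^ 2 := pow_le_pow_left₀ (by positivity) (by linarith) 2
      nlinarith [mul_nonneg x0 y0]
    have b1 := mul_le_mul_of_nonneg_left a1 (show 0 ≤ ℓ * c ^ 2 by positivity)
    have b2 := mul_le_mul_of_nonneg_left a2 (show 0 ≤ π + 2 * π ^ 3 by positivity)
    rw [hK, div_mul_eq_mul_div, le_div_iff₀ hpp]
    nlinarith
  refine le_of_sq_le_sq'' ?_ (by positivity)
  rw [mul_pow]
  refine hsq.trans (mul_le_mul_of_nonneg_right ?_ (sq_nonneg _))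
  nlinarith

/-! ## Main induction -/

lemma sm_data {ℓ ε : ℝ} {k : ℕ} {Fa F1 F2 ρ : P3 → ℝ} (hε : 0 < ε) {R : ℝ}
    (hR : XX ℓ k Fa + ε * XX ℓ k F1 + ε * XX ℓ k F2 + XX ℓ k ρ ≤ R) {a b : ℕ} (hab : a + b ≤ k) :
    YY ℓ b (pA^[a] Fa) + ε * YY ℓ b (pA^[a] F1) + ε * YY ℓ b (pA^[a] F2) + YY ℓ b (pA^[a] ρ) ≤ R := by
  have h1 := YY_iter_le (ℓ := ℓ) hab Fa
  have h2 := mul_le_mul_of_nonneg_left (YY_iter_le (ℓ := ℓ) hab F1) hε.le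
  have h3 := mul_le_mul_of_nonneg_left (YY_iter_le (ℓ := ℓ) hab F2) hε.le
  have h4 := YY_iter_le (ℓ := ℓ) hab ρ
  linarith

/-- the bounds on `∂_α W` -/
def PT (ℓ : ℝ) (k b : ℕ) (D : ℝ) : Prop := ∀ ε : ℝ, 0 < ε → ε < 1 →
    ∀ Wa W1 W2 Fa F1 F2 ρ : P3 → ℝ, Sys ℓ ε Wa W1 W2 Fa F1 F2 ρ → ∀ R : ℝ,
    XX ℓ k Fa + ε * XX ℓ k F1 + ε * XX ℓ k F2 + XX ℓ k ρ ≤ R → ∀ a : ℕ, a + b ≤ k →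
      ε * YY ℓ b (pA^[a + 1] W1) ≤ D * R ∧ ε * YY ℓ b (pA^[a + 1] W2) ≤ D * R ∧
      YY ℓ b (pA^[a + 1] Wa) ≤ D * R

/-- all the bounds -/
def PF (ℓ : ℝ) (k b : ℕ) (C : ℝ) : Prop := ∀ ε : ℝ, 0 < ε → ε < 1 →
    ∀ Wa W1 W2 Fa F1 F2 ρ : P3 → ℝ, Sys ℓ ε Wa W1 W2 Fa F1 F2 ρ → ∀ R : ℝ,
    XX ℓ k Fa + ε * XX ℓ k F1 + ε * XX ℓ k F2 + XX ℓ k ρ ≤ R → ∀ a : ℕ, a + b ≤ k →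
      ε * YY ℓ b (pA^[a + 1] W1) ≤ C * R ∧ ε * YY ℓ b (pA^[a + 1] W2) ≤ C * R ∧
      YY ℓ b (pA^[a + 1] Wa) ≤ C * R ∧
      YY ℓ (b + 1) (pA^[a] W1) ≤ C * R ∧ YY ℓ (b + 1) (pA^[a] W2) ≤ C * R

lemma red (ℓ : ℝ) (k b : ℕ) {D : ℝ} (hD : 0 ≤ D) (hyp : PT ℓ k b D) : ∃ C : ℝ, 0 ≤ C ∧ PF ℓ k b C := by
  obtain ⟨K, hK, hell⟩ := ell ℓ b
  refine ⟨D + K * (D + 1), by positivity, ?_⟩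
  intro ε hε hε1 Wa W1 W2 Fa F1 F2 ρ h R hR a hab
  obtain ⟨g1, g2, g3⟩ := hyp ε hε hε1 Wa W1 W2 Fa F1 F2 ρ h R hR a hab
  have dat := sm_data hε hR hab
  have y1 := YY_nonneg ℓ b (pA^[a] Fa)
  have y2 := mul_nonneg hε.le (YY_nonneg ℓ b (pA^[a] F1))
  have y3 := mul_nonneg hε.le (YY_nonneg ℓ b (pA^[a] F2))
  have y4 := YY_nonneg ℓ b (pA^[a] ρ)
  have R0 : 0 ≤ R := by linarith
  have hit := h.iter a
  have el := hell _ _ hit.s1 hit.s2 hit.tg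
  have ed : p1 (pA^[a] W1) + p2 (pA^[a] W2) = pA^[a] ρ - pA^[a + 1] Wa := by
    rw [← hit.er, Function.iterate_succ_apply', add_sub_cancel_left]
  rw [ed, hit.ea] at el
  have sb := YY_sub (ℓ := ℓ) b hit.tr (sm_iter h.sa (a + 1))
  have el2 : K * (YY ℓ b (pA^[a] ρ - pA^[a + 1] Wa) + YY ℓ b (pA^[a] Fa)) ≤ K * ((D + 1) * R) :=
    mul_le_mul_of_nonneg_left (by linarith) hK
  have n1 := YY_nonneg ℓ (b + 1) (pA^[a] W1)
  have n2 := YY_nonneg ℓ (b + 1) (pA^[a] W2)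
  have p1 : 0 ≤ K * (D + 1) * R := by positivity
  have p2 : 0 ≤ D * R := by positivity
  have e : (D + K * (D + 1)) * R = D * R + K * (D + 1) * R := by ring
  rw [e]
  refine ⟨by linarith, by linarith, by linarith, by linarith, by linarith⟩

lemma main_ind (ℓ : ℝ) (hℓ : 0 < ℓ) (k b : ℕ) : ∃ C : ℝ, 0 ≤ C ∧ PF ℓ k b C := by
  induction b with
  | zero =>
    refine red ℓ k 0 zero_le_one ?_
    intro ε hε hε1 Wa W1 W2 Fa F1 F2 ρ h R hR a hab
    have := energy_bd hℓ hε (h.iter a) (sm_data hε hR hab)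
    simp only [one_mul, Function.iterate_succ_apply']
    exact ⟨this.2.1, this.2.2, this.1⟩
  | succ b ih =>
    obtain ⟨C, hC, ih⟩ := ih
    refine red ℓ k (b + 1) (D := 1 + 2 * (C + 1) + C) (by positivity) ?_
    intro ε hε hε1 Wa W1 W2 Fa F1 F2 ρ h R hR a hab
    have hab' : (a + 1) + b ≤ k := by omega
    obtain ⟨g1, g2, g3, g4, g5⟩ := ih ε hε hε1 Wa W1 W2 Fa F1 F2 ρ h R hR (a + 1) hab'
    have dat := sm_data hε hR hab'
    have z1 := YY_nonneg ℓ b (pA^[a + 1] Fa)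
    have z2 := mul_nonneg hε.le (YY_nonneg ℓ b (pA^[a + 1] F1))
    have z3 := mul_nonneg hε.le (YY_nonneg ℓ b (pA^[a + 1] F2))
    have z4 := YY_nonneg ℓ b (pA^[a + 1] ρ)
    have R0 : 0 ≤ R := by linarith
    have CR : 0 ≤ C * R := by positivity
    have e : (1 + 2 * (C + 1) + C) * R = R + 2 * (C * R + R) + C * R := by ring
    rw [e]
    have m1 := mul_le_of_le_one_left (YY_nonneg ℓ (b + 1) (pA^[a + 1] W1)) hε1.le
    have m2 := mul_le_of_le_one_left (YY_nonneg ℓ (b + 1) (pA^[a + 1] W2)) hε1.le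
    refine ⟨by linarith, by linarith, ?_⟩
    have en := (energy_bd hℓ hε (h.iter a) (sm_data (a := a) (b := 0) hε hR (by omega))).1
    rw [← Function.iterate_succ_apply' pA] at en
    have hit := h.iter (a + 1)
    have s1 : Sm (pA (pA^[a + 1] W1)) := hit.s1.pA
    have s2 : Sm (pA (pA^[a + 1] W2)) := hit.s2.pA
    have u1 : YY ℓ b (p1 (pA^[a + 1] Wa)) ≤ C * R + R := by
      rw [hit.e2, YY_smul b (s1.sub' hit.t2), abs_of_nonneg (sq_nonneg ε)]
      have q := YY_sub (ℓ := ℓ) b s1 hit.t2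
      rw [← Function.iterate_succ_apply' pA] at q ⊢
      have q1 := mul_le_mul_of_nonneg_left q hε.le
      have q2 : ε * YY ℓ b (pA^[a + 1 + 1] W1 - pA^[a + 1] F2) ≤ C * R + R := by linarith
      have q3 := mul_le_mul_of_nonneg_left q2 hε.le
      have q4 := mul_le_of_le_one_left (add_nonneg CR R0) hε1.le
      nlinarith
    have u2 : YY ℓ b (p2 (pA^[a + 1] Wa)) ≤ C * R + R := by
      rw [hit.e1, YY_smul b (hit.t1.add' s2), abs_of_nonneg (sq_nonneg ε)]
      have q := YY_add (ℓ := ℓ) b hit.t1 s2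
      rw [← Function.iterate_succ_apply' pA] at q ⊢
      have q1 := mul_le_mul_of_nonneg_left q hε.le
      have q2 : ε * YY ℓ b (pA^[a + 1] F1 + pA^[a + 1 + 1] W2) ≤ C * R + R := by linarith
      have q3 := mul_le_mul_of_nonneg_left q2 hε.le
      have q4 := mul_le_of_le_one_left (add_nonneg CR R0) hε1.le
      nlinarith
    have e2 : YY ℓ (b + 1) (pA^[a + 1] Wa) = nn ℓ (pA^[a + 1] Wa) + YY ℓ b (p1 (pA^[a + 1] Wa))
      + YY ℓ b (p2 (pA^[a + 1] Wa)) := rfl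
    rw [e2]; linarith

lemma main_all (ℓ : ℝ) (hℓ : 0 < ℓ) (k : ℕ) : ∃ C : ℝ, 0 ≤ C ∧ ∀ b, b ≤ k → PF ℓ k b C := by
  choose C hC hP using main_ind ℓ hℓ k
  refine ⟨∑ b ∈ Finset.range (k + 1), C b, Finset.sum_nonneg fun b _ => hC b, fun b hb => ?_⟩
  have le : C b ≤ ∑ b ∈ Finset.range (k + 1), C b :=
    Finset.single_le_sum (fun i _ => hC i) (Finset.mem_range.2 (by omega))
  intro ε hε hε1 Wa W1 W2 Fa F1 F2 ρ h R hR a hab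
  obtain ⟨g1, g2, g3, g4, g5⟩ := hP b ε hε hε1 Wa W1 W2 Fa F1 F2 ρ h R hR a hab
  have z1 := XX_nonneg ℓ k Fa
  have z2 := mul_nonneg hε.le (XX_nonneg ℓ k F1)
  have z3 := mul_nonneg hε.le (XX_nonneg ℓ k F2)
  have z4 := XX_nonneg ℓ k ρ
  have R0 : 0 ≤ R := by linarith
  have := mul_le_mul_of_nonneg_right le R0
  exact ⟨g1.trans this, g2.trans this, g3.trans this, g4.trans this, g5.trans this⟩

/-- all the estimates in terms of the equivalent norms `XX` -/
lemma main_XX (ℓ : ℝ) (hℓ : 0 < ℓ) (k : ℕ) : ∃ C : ℝ, 0 ≤ C ∧ ∀ ε : ℝ, 0 < ε → ε < 1 →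
    ∀ Wa W1 W2 Fa F1 F2 ρ : P3 → ℝ, Sys ℓ ε Wa W1 W2 Fa F1 F2 ρ → ∀ R : ℝ,
    XX ℓ k Fa + ε * XX ℓ k F1 + ε * XX ℓ k F2 + XX ℓ k ρ ≤ R →
      (XX ℓ k Wa ≤ C * (ε * R + XX ℓ k ρ + |II ℓ Wa|) ∧ XX ℓ k (p1 Wa) ≤ C * (ε * R) ∧
        XX ℓ k (p2 Wa) ≤ C * (ε * R)) ∧
      XX ℓ k (pA Wa) ≤ C * R ∧
      (XX ℓ k W1 ≤ C * R ∧ XX ℓ k W2 ≤ C * R ∧ ε * XX ℓ k (pA W1) ≤ C * R ∧ ε * XX ℓ k (pA W2) ≤ C * R ∧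
       XX ℓ k (p1 W1) ≤ C * R ∧ XX ℓ k (p2 W1) ≤ C * R ∧ XX ℓ k (p1 W2) ≤ C * R ∧ XX ℓ k (p2 W2) ≤ C * R) := by
  obtain ⟨C, hC, hP⟩ := main_all ℓ hℓ k
  obtain ⟨K, hK, hS⟩ := slow_bd ℓ hℓ
  set C1 : ℝ := 4 ^ k * (C + 1) with hC1
  have hC10 : 0 ≤ C1 := by positivity
  set C2 : ℝ := K * (2 * C1 + 1) + 2 * C1 with hC2
  have hC20 : 0 ≤ C2 := by positivity
  refine ⟨C1 + 4 ^ k * C2, by positivity, ?_⟩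
  intro ε hε hε1 Wa W1 W2 Fa F1 F2 ρ h R hR
  have z1 := XX_nonneg ℓ k Fa
  have z2 := mul_nonneg hε.le (XX_nonneg ℓ k F1)
  have z3 := mul_nonneg hε.le (XX_nonneg ℓ k F2)
  have z4 := XX_nonneg ℓ k ρ
  have R0 : 0 ≤ R := by linarith
  have εR : 0 ≤ ε * R := by positivity
  have CR : C * R ≤ (C + 1) * R := by nlinarith
  have bd := fun a b (hab : a + b ≤ k) => hP b (by omega) ε hε hε1 Wa W1 W2 Fa F1 F2 ρ h R hR a hab
  have w : ∀ x : ℝ, 0 ≤ x → C1 * x ≤ (C1 + 4 ^ k * C2) * x := fun x hx => by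
    have : 0 ≤ 4 ^ k * C2 * x := by positivity
    linarith
  have fin : ∀ f : P3 → ℝ, Sm f → (∀ a b, a + b ≤ k → YY ℓ b (pA^[a] f) ≤ C * R) →
      XX ℓ k f ≤ (C1 + 4 ^ k * C2) * R := by
    intro f sf hf
    refine (XX_le_of_YY k sf fun a b hab => (hf a b hab).trans CR).trans ?_
    rw [← mul_assoc]; exact w R R0
  have finε : ∀ f : P3 → ℝ, Sm f → (∀ a b, a + b ≤ k → ε * YY ℓ b (pA^[a] f) ≤ C * R) →
      ε * XX ℓ k f ≤ (C1 + 4 ^ k * C2) * R := by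
    intro f sf hf
    have := XX_le_of_YY (B := (C + 1) * R / ε) k sf fun a b hab => by
      rw [le_div_iff₀ hε]; linarith [hf a b hab]
    have h2 := mul_le_mul_of_nonneg_left this hε.le
    refine h2.trans ((le_of_eq ?_).trans (w R R0))
    rw [hC1]; field_simp
  have g1 : XX ℓ k (p1 Wa) ≤ C1 * (ε * R) := by
    have : 4 ^ k * ((C + 1) * (ε * R)) = C1 * (ε * R) := by rw [hC1]; ring
    rw [← this]
    refine XX_le_of_YY k h.sa.p1 fun a b hab => ?_
    have hit := h.iter a
    rw [iter_p1 h.sa, hit.e2, YY_smul b (hit.s1.pA.sub' hit.t2), abs_of_nonneg (sq_nonneg ε)]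
    have q := YY_sub (ℓ := ℓ) b hit.s1.pA hit.t2
    have q1 := mul_le_mul_of_nonneg_left q hε.le
    have q2 := (bd a b hab).1
    rw [Function.iterate_succ_apply' pA] at q2
    have dat := sm_data hε hR hab
    have y1 := YY_nonneg ℓ b (pA^[a] Fa)
    have y2 := mul_nonneg hε.le (YY_nonneg ℓ b (pA^[a] F1))
    have y4 := YY_nonneg ℓ b (pA^[a] ρ)
    have q3 : ε * YY ℓ b (pA (pA^[a] W1) - pA^[a] F2) ≤ (C + 1) * R := by linarith
    have q4 := mul_le_mul_of_nonneg_left q3 hε.le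
    linarith
  have g2 : XX ℓ k (p2 Wa) ≤ C1 * (ε * R) := by
    have : 4 ^ k * ((C + 1) * (ε * R)) = C1 * (ε * R) := by rw [hC1]; ring
    rw [← this]
    refine XX_le_of_YY k h.sa.p2 fun a b hab => ?_
    have hit := h.iter a
    rw [iter_p2 h.sa, hit.e1, YY_smul b (hit.t1.add' hit.s2.pA), abs_of_nonneg (sq_nonneg ε)]
    have q := YY_add (ℓ := ℓ) b hit.t1 hit.s2.pA
    have q1 := mul_le_mul_of_nonneg_left q hε.le
    have q2 := (bd a b hab).2.1
    rw [Function.iterate_succ_apply' pA] at q2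
    have dat := sm_data hε hR hab
    have y1 := YY_nonneg ℓ b (pA^[a] Fa)
    have y2 := mul_nonneg hε.le (YY_nonneg ℓ b (pA^[a] F2))
    have y4 := YY_nonneg ℓ b (pA^[a] ρ)
    have q3 : ε * YY ℓ b (pA^[a] F1 + pA (pA^[a] W2)) ≤ (C + 1) * R := by linarith
    have q4 := mul_le_mul_of_nonneg_left q3 hε.le
    linarith
  have Q0 := abs_nonneg (II ℓ Wa)
  set T := ε * R + XX ℓ k ρ + |II ℓ Wa| with hT
  have T0 : 0 ≤ T := by positivity
  have g3 : XX ℓ k Wa ≤ 4 ^ k * (C2 * T) := by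
    have hn : ∀ a, a ≤ k → nn ℓ (pA^[a] Wa) ≤ K * (2 * C1 + 1) * T := by
      intro a ha
      have hit := h.iter a
      have s := hS _ _ _ _ hit.sa hit.s1 hit.s2 hit.tr hit.tg hit.er
      have i1 : nn ℓ (p1 (pA^[a] Wa)) ≤ C1 * (ε * R) := by
        rw [← iter_p1 h.sa]; exact (YY_iter_le (b := 0) (by omega) (p1 Wa)).trans g1
      have i2 : nn ℓ (p2 (pA^[a] Wa)) ≤ C1 * (ε * R) := by
        rw [← iter_p2 h.sa]; exact (YY_iter_le (b := 0) (by omega) (p2 Wa)).trans g2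
      have i3 : nn ℓ (pA^[a] ρ) ≤ XX ℓ k ρ := YY_iter_le (b := 0) (by omega) ρ
      have i4 : |II ℓ (pA^[a] Wa)| ≤ |II ℓ Wa| := by
        cases a with
        | zero => exact le_rfl
        | succ a =>
          rw [Function.iterate_succ_apply', II_pA hℓ (sm_iter h.sa a) (per_iter h.pa a)]
          simp
      refine s.trans ?_
      rw [mul_assoc]
      refine mul_le_mul_of_nonneg_left ?_ hK
      have : 0 ≤ C1 * XX ℓ k ρ := by positivity
      have : 0 ≤ C1 * |II ℓ Wa| := by positivity
      rw [hT]; linarith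
    refine XX_le_of_YY k h.sa fun a b hab => ?_
    have n := hn a (by omega)
    have c1T : C1 * (ε * R) ≤ C1 * T := mul_le_mul_of_nonneg_left (by rw [hT]; linarith) hC10
    have c1T0 : 0 ≤ C1 * T := by positivity
    cases b with
    | zero =>
      change nn ℓ (pA^[a] Wa) ≤ _
      rw [hC2]; linarith
    | succ b =>
      have e2 : YY ℓ (b + 1) (pA^[a] Wa) = nn ℓ (pA^[a] Wa) + YY ℓ b (p1 (pA^[a] Wa))
        + YY ℓ b (p2 (pA^[a] Wa)) := rfl
      have i1 : YY ℓ b (p1 (pA^[a] Wa)) ≤ C1 * (ε * R) := by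
        rw [← iter_p1 h.sa]; exact (YY_iter_le (by omega) (p1 Wa)).trans g1
      have i2 : YY ℓ b (p2 (pA^[a] Wa)) ≤ C1 * (ε * R) := by
        rw [← iter_p2 h.sa]; exact (YY_iter_le (by omega) (p2 Wa)).trans g2
      rw [e2, hC2]; linarith
  refine ⟨⟨?_, g1.trans (w _ εR), g2.trans (w _ εR)⟩, ?_, ?_, ?_, ?_, ?_, ?_, ?_, ?_, ?_⟩
  · have : 0 ≤ C1 * T := by positivity
    linarith
  · exact fin _ h.sa.pA fun a b hab => (bd a b hab).2.2.1
  · exact fin _ h.s1 fun a b hab => (YY_succ b _).trans (bd a b hab).2.2.2.1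
  · exact fin _ h.s2 fun a b hab => (YY_succ b _).trans (bd a b hab).2.2.2.2
  · exact finε _ h.s1.pA fun a b hab => (bd a b hab).1
  · exact finε _ h.s2.pA fun a b hab => (bd a b hab).2.1
  · refine fin _ h.s1.p1 fun a b hab => ?_
    rw [iter_p1 h.s1]; exact (YY_p1 b _).trans (bd a b hab).2.2.2.1
  · refine fin _ h.s1.p2 fun a b hab => ?_
    rw [iter_p2 h.s1]; exact (YY_p2 b _).trans (bd a b hab).2.2.2.1
  · refine fin _ h.s2.p1 fun a b hab => ?_
    rw [iter_p1 h.s2]; exact (YY_p1 b _).trans (bd a b hab).2.2.2.2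
  · refine fin _ h.s2.p2 fun a b hab => ?_
    rw [iter_p2 h.s2]; exact (YY_p2 b _).trans (bd a b hab).2.2.2.2

/-! ## Conclusion -/

lemma sqrt_add_le2 {x y a b : ℝ} (hy : 0 ≤ y) (ha : Real.sqrt x ≤ a)
    (hb : Real.sqrt y ≤ b) : Real.sqrt (x + y) ≤ a + b := by
  have a0 : 0 ≤ a := (Real.sqrt_nonneg _).trans ha
  have b0 : 0 ≤ b := (Real.sqrt_nonneg _).trans hb
  have h1 := (Real.sqrt_le_left a0).1 ha
  have h2 := (Real.sqrt_le_left b0).1 hb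
  refine Real.sqrt_le_iff.2 ⟨by positivity, ?_⟩
  nlinarith [mul_nonneg a0 b0]

/-- **Optimal estimates for the constant-coefficient system** (Proposition 5.4).
If `W` is tangent to the boundary and satisfies `Curl W = F`, `ddiv W = ρ`, then the
stated `H^k` estimates hold with constants `C_k` independent of `ε`. -/
theorem constant_coefficient_curl_estimates
    (ℓ : ℝ) (hℓ : 0 < ℓ) (k : ℕ) :
    ∃ C > (0 : ℝ), ∃ ε₀ > (0 : ℝ), ∀ ε : ℝ, 0 < ε → ε < ε₀ →
      ∀ Wa W1 W2 Fa F1 F2 ρ : P3 → ℝ,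
        ContDiff ℝ (⊤ : ℕ∞) Wa → ContDiff ℝ (⊤ : ℕ∞) W1 → ContDiff ℝ (⊤ : ℕ∞) W2 →
        PerA ℓ Wa → PerA ℓ W1 → PerA ℓ W2 →
        TangentP W1 W2 →
        (∀ p : P3, curlPα Wa W1 W2 p = Fa p ∧ curlP1 ε Wa W1 W2 p = F1 p ∧
          curlP2 ε Wa W1 W2 p = F2 p ∧ ddivP Wa W1 W2 p = ρ p) →
        -- (i)
        (Real.sqrt (SobSq ℓ k Wa) +
            Real.sqrt (SobSq ℓ k (p1 Wa) + SobSq ℓ k (p2 Wa)) ≤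
          C * (ε * Real.sqrt (HkEpsSq ε ℓ k Fa F1 F2) + Real.sqrt (SobSq ℓ k ρ) +
            |QP ℓ Wa|)) ∧
        -- (ii)
        (Real.sqrt (SobSq ℓ k (pA Wa)) ≤
          C * (Real.sqrt (HkEpsSq ε ℓ k Fa F1 F2) + Real.sqrt (SobSq ℓ k ρ))) ∧
        -- (iii)
        (Real.sqrt (SobSq ℓ k W1 + SobSq ℓ k W2) +
            ε * Real.sqrt (SobSq ℓ k (pA W1) + SobSq ℓ k (pA W2)) +
            Real.sqrt (SobSq ℓ k (p1 W1) + SobSq ℓ k (p2 W1) +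
              SobSq ℓ k (p1 W2) + SobSq ℓ k (p2 W2)) ≤
          C * (Real.sqrt (HkEpsSq ε ℓ k Fa F1 F2) + Real.sqrt (SobSq ℓ k ρ) +
            |QP ℓ Wa|)) := by
  obtain ⟨C, hC, hM⟩ := main_XX ℓ hℓ k
  set M : ℝ := 4 ^ k with hMdef
  have hM1 : 1 ≤ M := one_le_pow₀ (by norm_num)
  set N : ℝ := (k : ℝ) + 1 with hN
  have hN0 : 0 ≤ N := by positivity
  set D : ℝ := N * C * (3 * M) with hD
  have hD0 : 0 ≤ D := by positivity
  refine ⟨8 * D + 1, by positivity, 1, one_pos, ?_⟩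
  intro ε hε hε1 Wa W1 W2 Fa F1 F2 ρ sa s1 s2 pa q1 q2 tg heq
  have hε2 : ε ^ 2 ≠ 0 := by positivity
  have fa : Fa = p1 W2 - p2 W1 := by
    funext p; exact ((heq p).1).symm
  have f1 : F1 = (ε ^ 2)⁻¹ • p2 Wa - pA W2 := by
    funext p; exact ((heq p).2.1).symm
  have f2 : F2 = pA W1 - (ε ^ 2)⁻¹ • p1 Wa := by
    funext p; exact ((heq p).2.2.1).symm
  have fr : ρ = pA Wa + (p1 W1 + p2 W2) := by
    funext p
    rw [← (heq p).2.2.2]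
    simp only [ddivP, Pi.add_apply]; ring
  have hs : Sys ℓ ε Wa W1 W2 Fa F1 F2 ρ :=
    { sa := sa
      s1 := s1
      s2 := s2
      ta := by rw [fa]; exact (Sm.p1 s2).sub' (Sm.p2 s1)
      t1 := by rw [f1]; exact ((Sm.p2 sa).smul' _).sub' (Sm.pA s2)
      t2 := by rw [f2]; exact (Sm.pA s1).sub' ((Sm.p1 sa).smul' _)
      tr := by rw [fr]; exact (Sm.pA sa).add' ((Sm.p1 s1).add' (Sm.p2 s2))
      pa := pa
      q1 := q1
      q2 := q2
      tg := tg
      ea := fa.symm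
      e1 := by rw [f1, sub_add_cancel, smul_smul, mul_inv_cancel₀ hε2, one_smul]
      e2 := by rw [f2, sub_sub_cancel, smul_smul, mul_inv_cancel₀ hε2, one_smul]
      er := fr.symm }
  set H : ℝ := Real.sqrt (HkEpsSq ε ℓ k Fa F1 F2) with hH
  set r : ℝ := Real.sqrt (SobSq ℓ k ρ) with hr
  have H0 : 0 ≤ H := Real.sqrt_nonneg _
  have r0 : 0 ≤ r := Real.sqrt_nonneg _
  have na := SobSq_nonneg ℓ k Fa
  have n1 := SobSq_nonneg ℓ k F1
  have n2 := SobSq_nonneg ℓ k F2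
  have m1 : 0 ≤ ε ^ 2 * SobSq ℓ k F1 := by positivity
  have m2 : 0 ≤ ε ^ 2 * SobSq ℓ k F2 := by positivity
  have ba : Real.sqrt (SobSq ℓ k Fa) ≤ H := by
    refine Real.sqrt_le_sqrt ?_
    unfold HkEpsSq; linarith
  have b1 : ε * Real.sqrt (SobSq ℓ k F1) ≤ H := by
    refine Real.le_sqrt_of_sq_le ?_
    rw [mul_pow, Real.sq_sqrt n1]
    unfold HkEpsSq; linarith
  have b2 : ε * Real.sqrt (SobSq ℓ k F2) ≤ H := by
    refine Real.le_sqrt_of_sq_le ?_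
    rw [mul_pow, Real.sq_sqrt n2]
    unfold HkEpsSq; linarith
  have ca : XX ℓ k Fa ≤ M * H :=
    (XX_le_sqrt k hs.ta).trans (mul_le_mul_of_nonneg_left ba (by positivity))
  have c1 : ε * XX ℓ k F1 ≤ M * H := by
    have := mul_le_mul_of_nonneg_left (XX_le_sqrt (ℓ := ℓ) k hs.t1) hε.le
    have h2 := mul_le_mul_of_nonneg_left b1 (show 0 ≤ M by positivity)
    calc _ ≤ _ := this
      _ = M * (ε * Real.sqrt (SobSq ℓ k F1)) := by ring
      _ ≤ _ := h2
  have c2 : ε * XX ℓ k F2 ≤ M * H := by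
    have := mul_le_mul_of_nonneg_left (XX_le_sqrt (ℓ := ℓ) k hs.t2) hε.le
    have h2 := mul_le_mul_of_nonneg_left b2 (show 0 ≤ M by positivity)
    calc _ ≤ _ := this
      _ = M * (ε * Real.sqrt (SobSq ℓ k F2)) := by ring
      _ ≤ _ := h2
  have cr : XX ℓ k ρ ≤ M * r := XX_le_sqrt k hs.tr
  obtain ⟨⟨u1, u2, u3⟩, u4, v1, v2, v3, v4, v5, v6, v7, v8⟩ :=
    hM ε hε hε1 Wa W1 W2 Fa F1 F2 ρ hs (M * (3 * H + r)) (by linarith)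
  have hQ : II ℓ Wa = QP ℓ Wa := rfl
  rw [hQ] at u1
  set Q : ℝ := |QP ℓ Wa| with hQd
  have Q0 : 0 ≤ Q := abs_nonneg _
  have M0 : 0 ≤ M := by positivity
  have MQ : Q ≤ M * Q := le_mul_of_one_le_left Q0 hM1
  have MQ0 : 0 ≤ M * Q := by positivity
  have Mr0 : 0 ≤ M * r := by positivity
  have MH0 : 0 ≤ M * H := by positivity
  have Meh : 0 ≤ M * (ε * H) := by positivity
  have eMr : ε * (M * r) ≤ M * r := mul_le_of_le_one_left Mr0 hε1.le
  have X1 : ε * (M * (3 * H + r)) ≤ 3 * M * (ε * H + r + Q) := by linarith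
  have X2 : ε * (M * (3 * H + r)) + XX ℓ k ρ + Q ≤ 3 * M * (ε * H + r + Q) := by linarith
  have X3 : M * (3 * H + r) ≤ 3 * M * (H + r) := by linarith
  have key : ∀ f : P3 → ℝ, Sm f → ∀ t s : ℝ, XX ℓ k f ≤ C * t → t ≤ 3 * M * s →
      Real.sqrt (SobSq ℓ k f) ≤ D * s := by
    intro f hf t s h1 h2
    have a1 := sqrt_SobSq_le (ℓ := ℓ) k hf
    have a2 := h1.trans (mul_le_mul_of_nonneg_left h2 hC)
    calc _ ≤ _ := a1
      _ ≤ N * (C * (3 * M * s)) := mul_le_mul_of_nonneg_left a2 hN0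
      _ = D * s := by rw [hD]; ring
  have keye : ∀ f : P3 → ℝ, Sm f → ε * XX ℓ k f ≤ C * (M * (3 * H + r)) →
      ε * Real.sqrt (SobSq ℓ k f) ≤ D * (H + r) := by
    intro f hf h1
    have a1 := mul_le_mul_of_nonneg_left (sqrt_SobSq_le (ℓ := ℓ) k hf) hε.le
    have a2 := h1.trans (mul_le_mul_of_nonneg_left X3 hC)
    calc _ ≤ _ := a1
      _ = N * (ε * XX ℓ k f) := by rw [hN]; ring
      _ ≤ N * (C * (3 * M * (H + r))) := mul_le_mul_of_nonneg_left a2 hN0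
      _ = D * (H + r) := by rw [hD]; ring
  have S0 : 0 ≤ ε * H + r + Q := by positivity
  have T0 : 0 ≤ H + r := by positivity
  have DS0 := mul_nonneg hD0 S0
  have DT0 := mul_nonneg hD0 T0
  have DQ0 := mul_nonneg hD0 Q0
  refine ⟨?_, ?_, ?_⟩
  · have w1 := key _ sa _ _ u1 X2
    have w2 := sqrt_add_le2 (SobSq_nonneg ℓ k (p2 Wa)) (key _ (Sm.p1 sa) _ _ u2 X1)
      (key _ (Sm.p2 sa) _ _ u3 X1)
    linarith
  · have w1 := key _ (Sm.pA sa) _ _ u4 X3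
    linarith
  · have w1 := sqrt_add_le2 (SobSq_nonneg ℓ k W2) (key _ s1 _ _ v1 X3) (key _ s2 _ _ v2 X3)
    have w2 := mul_le_mul_of_nonneg_left (sqrt_add_le2 (SobSq_nonneg ℓ k (pA W2))
      (le_refl (Real.sqrt (SobSq ℓ k (pA W1)))) (le_refl (Real.sqrt (SobSq ℓ k (pA W2))))) hε.le
    have w3 := keye _ (Sm.pA s1) v3
    have w4 := keye _ (Sm.pA s2) v4
    have w5 := sqrt_add_le2 (SobSq_nonneg ℓ k (p2 W2))
      (sqrt_add_le2 (SobSq_nonneg ℓ k (p1 W2))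
        (sqrt_add_le2 (SobSq_nonneg ℓ k (p2 W1)) (key _ (Sm.p1 s1) _ _ v5 X3)
          (key _ (Sm.p2 s1) _ _ v6 X3)) (key _ (Sm.p1 s2) _ _ v7 X3)) (key _ (Sm.p2 s2) _ _ v8 X3)
    linarith
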